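/- Assume the Setup: f ∈ R_9 satisfies (C1)–(C3), D is an irreducible homogeneous locally nilpotent derivation of R with D²(f) = 0, and g, h are homogeneous elements with ker D = k[g,h], d = deg g ≤ e = deg h. Then: (a) f is a local slice for D (i.e., Df ≠ 0); (b) z ∉ ker D; (c) up to multiplication by an element of k*, g equals y + az² for some a ∈ k, or x + ayz + bz³ for some a, b ∈ k; in particular g is a variable of R; (d) the rank of D equals 2; (e) 2 ≤ d ≤ 3 and e ≥ 5. -/

import Mathlib

open MvPolynomial

set_option synthInstance.maxHeartbeats 400000
set_option maxHeartbeats 1000000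

noncomputable section

/-- The grading weights `(3, 2, 1)` for the variables `x = X 0`, `y = X 1`, `z = X 2`
of `R = k[x,y,z]`. -/
def w3 : Fin 3 → ℕ := ![3, 2, 1]

/-- `D` is a locally nilpotent derivation: every element is killed by some power of `D`. -/
def IsLND {k B : Type*} [CommRing k] [CommRing B] [Algebra k B]
    (D : Derivation k B B) : Prop :=
  ∀ b : B, ∃ n : ℕ, (⇑D)^[n] b = 0

/-- A derivation `D` is irreducible if the only principal ideal of `B` containing the
image of `D` is `B` itself. -/
def IsIrreducibleDeriv {k B : Type*} [CommRing k] [CommRing B] [Algebra k B]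
    (D : Derivation k B B) : Prop :=
  ∀ b : B, (∀ r : B, D r ∈ Ideal.span {b}) → IsUnit b

/-- `D` is a homogeneous derivation of degree `m` with respect to the `ℕ`-grading of
`k[x,y,z]` in which the variables have weights `w`, i.e. `D(R_i) ⊆ R_{i+m}` for all `i`. -/
def DerivIsHomogOfDeg {k : Type} [Field k] (w : Fin 3 → ℕ)
    (D : Derivation k (MvPolynomial (Fin 3) k) (MvPolynomial (Fin 3) k)) (m : ℤ) : Prop :=
  ∀ (i : ℕ) (f : MvPolynomial (Fin 3) k), f.IsWeightedHomogeneous w i →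
    (∀ j : ℕ, (j : ℤ) = (i : ℤ) + m → (D f).IsWeightedHomogeneous w j) ∧
    ((i : ℤ) + m < 0 → D f = 0)

/-- `S` is a regular local ring: a Noetherian local ring whose maximal ideal (equivalently,
its Jacobson radical) can be generated by Krull-dimension many elements. -/
def IsRegLocalRing (S : Type*) [CommRing S] : Prop :=
  IsNoetherianRing S ∧ IsLocalRing S ∧
    ∃ s : Finset S, Ideal.span (s : Set S) = (⊥ : Ideal S).jacobson ∧
      (s.card : WithBot (WithTop ℕ)) = ringKrullDim S

/-- The scheme `Proj ℬ` has at least two singular points, i.e. two distinct points whose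
local rings (the stalks of the structure sheaf) are not regular local rings. -/
def ProjHasTwoSingularPoints (k : Type) [Field k] {A : Type} [CommRing A] [Algebra k A]
    (ℬ : ℕ → Submodule k A) [GradedAlgebra ℬ] : Prop :=
  ∃ x y : AlgebraicGeometry.Proj ℬ, x ≠ y ∧
    ¬ IsRegLocalRing ((AlgebraicGeometry.Proj ℬ).presheaf.stalk x) ∧
    ¬ IsRegLocalRing ((AlgebraicGeometry.Proj ℬ).presheaf.stalk y)

/-- Condition (C2): the projective curve `Proj (R/fR)` has at least two singular points.
Here the grading on `R/fR` is the (unique) `ℕ`-grading `ℬ` induced by the weighted grading of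
`R = k[x,y,z]` with weights `(3,2,1)` via the quotient map. -/
def CondC2 (k : Type) [Field k] (f : MvPolynomial (Fin 3) k) : Prop :=
  ∃ (ℬ : ℕ → Submodule k (MvPolynomial (Fin 3) k ⧸ Ideal.span {f}))
    (inst : GradedAlgebra ℬ),
    (∀ (i : ℕ) (r : MvPolynomial (Fin 3) k), r.IsWeightedHomogeneous w3 i →
      Ideal.Quotient.mk (Ideal.span {f}) r ∈ ℬ i) ∧
    @ProjHasTwoSingularPoints k _ _ _ _ ℬ inst

/-- Condition (C3): `f(x,y,0) = x (p x² + q y³)` for some `p, q ∈ k*`. -/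
def CondC3 (k : Type) [Field k] (f : MvPolynomial (Fin 3) k) : Prop :=
  ∃ p q : k, p ≠ 0 ∧ q ≠ 0 ∧
    aeval ![X 0, X 1, 0] f = X 0 * (C p * X 0 ^ 2 + C q * X 1 ^ 3)

/-- `D` has corank at least `r`: there is a system of variables (coordinate system) of
`k[x,y,z]` whose first `r` coordinates lie in the kernel of `D`. -/
def CorankGe {k : Type} [Field k]
    (D : Derivation k (MvPolynomial (Fin 3) k) (MvPolynomial (Fin 3) k)) (r : ℕ) : Prop :=
  ∃ α : MvPolynomial (Fin 3) k ≃ₐ[k] MvPolynomial (Fin 3) k,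
    ∀ i : Fin 3, (i : ℕ) < r → D (α (X i)) = 0

namespace S15

abbrev R3 (k : Type) [Field k] := MvPolynomial (Fin 3) k

section Flow
variable {k : Type} [Field k] [CharZero k]

def flowFun (D : Derivation k (R3 k) (R3 k)) (hD : IsLND D) (p : Fin 3 → k) (r : R3 k) :
    Polynomial k :=
  ∑ i ∈ Finset.range (hD r).choose,
    Polynomial.monomial i (eval p ((⇑D)^[i] r) / (i.factorial : k))

lemma iterate_zero_of_ge (D : Derivation k (R3 k) (R3 k)) (r : R3 k) (n : ℕ)
    (h : (⇑D)^[n] r = 0) (i : ℕ) (hi : n ≤ i) : (⇑D)^[i] r = 0 := by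
  obtain ⟨j, rfl⟩ := Nat.exists_eq_add_of_le hi
  rw [add_comm, Function.iterate_add_apply, h]
  exact iterate_map_zero D j

lemma coeff_flowFun (D : Derivation k (R3 k) (R3 k)) (hD : IsLND D) (p : Fin 3 → k) (r : R3 k)
    (i : ℕ) : (flowFun D hD p r).coeff i = eval p ((⇑D)^[i] r) / (i.factorial : k) := by
  simp only [flowFun, Polynomial.finset_sum_coeff, Polynomial.coeff_monomial]
  rw [Finset.sum_ite_eq']
  split_ifs with h
  · rfl
  · rw [iterate_zero_of_ge D r _ (hD r).choose_spec i (by simpa using h)]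
    simp

lemma deriv_flowFun (D : Derivation k (R3 k) (R3 k)) (hD : IsLND D) (p : Fin 3 → k) (r : R3 k) :
    Polynomial.derivative (flowFun D hD p r) = flowFun D hD p (D r) := by
  ext i
  rw [Polynomial.coeff_derivative, coeff_flowFun, coeff_flowFun, Function.iterate_succ_apply,
    Nat.factorial_succ]
  have : (i.factorial : k) ≠ 0 := by exact_mod_cast i.factorial_ne_zero
  have h2 : ((i : k) + 1) ≠ 0 := by exact_mod_cast Nat.succ_ne_zero i
  push_cast
  field_simp

lemma flowFun_add (D : Derivation k (R3 k) (R3 k)) (hD : IsLND D) (p : Fin 3 → k) (r s : R3 k) :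
    flowFun D hD p (r + s) = flowFun D hD p r + flowFun D hD p s := by
  ext i
  rw [Polynomial.coeff_add, coeff_flowFun, coeff_flowFun, coeff_flowFun, iterate_map_add]
  simp [add_div]

lemma flowFun_mul (D : Derivation k (R3 k) (R3 k)) (hD : IsLND D) (p : Fin 3 → k) (r s : R3 k) :
    flowFun D hD p (r * s) = flowFun D hD p r * flowFun D hD p s := by
  ext i
  induction i generalizing r s with
  | zero => simp [Polynomial.mul_coeff_zero, coeff_flowFun]
  | succ n ih =>
    have h2 : ((n : k) + 1) ≠ 0 := by exact_mod_cast Nat.succ_ne_zero n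
    apply mul_right_cancel₀ h2
    rw [← Polynomial.coeff_derivative, ← Polynomial.coeff_derivative, deriv_flowFun,
      Derivation.leibniz, Polynomial.derivative_mul, deriv_flowFun, deriv_flowFun, flowFun_add,
      Polynomial.coeff_add, Polynomial.coeff_add, smul_eq_mul, smul_eq_mul, ih, ih,
      mul_comm (flowFun D hD p s), add_comm]

lemma flowFun_C (D : Derivation k (R3 k) (R3 k)) (hD : IsLND D) (p : Fin 3 → k) (c : k) :
    flowFun D hD p (C c) = Polynomial.C c := by
  ext i
  rw [coeff_flowFun, Polynomial.coeff_C]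
  cases i with
  | zero => simp
  | succ n =>
    have : D (C c) = 0 := by
      have := D.map_algebraMap c
      simpa using this
    rw [Function.iterate_succ_apply, this, iterate_map_zero D n]
    simp

def flow (D : Derivation k (R3 k) (R3 k)) (hD : IsLND D) (p : Fin 3 → k) :
    R3 k →ₐ[k] Polynomial k where
  toFun := flowFun D hD p
  map_one' := by simpa using flowFun_C D hD p 1
  map_mul' := flowFun_mul D hD p
  map_zero' := by simpa using flowFun_C D hD p 0
  map_add' := flowFun_add D hD p
  commutes' := by intro c; exact flowFun_C D hD p c

lemma coeff_flow (D : Derivation k (R3 k) (R3 k)) (hD : IsLND D) (p : Fin 3 → k) (r : R3 k)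
    (i : ℕ) : (flow D hD p r).coeff i = eval p ((⇑D)^[i] r) / (i.factorial : k) :=
  coeff_flowFun D hD p r i

lemma deriv_flow (D : Derivation k (R3 k) (R3 k)) (hD : IsLND D) (p : Fin 3 → k) (r : R3 k) :
    Polynomial.derivative (flow D hD p r) = flow D hD p (D r) :=
  deriv_flowFun D hD p r

lemma eval_zero_flow (D : Derivation k (R3 k) (R3 k)) (hD : IsLND D) (p : Fin 3 → k) (r : R3 k) :
    (flow D hD p r).eval 0 = eval p r := by
  rw [← Polynomial.coeff_zero_eq_eval_zero, coeff_flow]; simp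

/-- the point flowed for time `t` -/
def flowPt (D : Derivation k (R3 k) (R3 k)) (hD : IsLND D) (p : Fin 3 → k) (t : k) : Fin 3 → k :=
  fun i => (flow D hD p (X i)).eval t

lemma eval_flow (D : Derivation k (R3 k) (R3 k)) (hD : IsLND D) (p : Fin 3 → k) (t : k)
    (r : R3 k) : (flow D hD p r).eval t = eval (flowPt D hD p t) r := by
  have : (Polynomial.aeval t).comp (flow D hD p) = aeval (flowPt D hD p t) := by
    ext i
    simp [flowPt, Polynomial.aeval_def, Polynomial.eval₂_eq_eval_map]
  have h := DFunLike.congr_fun this r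
  simpa [Polynomial.coe_aeval_eq_eval, MvPolynomial.aeval_eq_eval] using h

lemma flow_eq_zero_of_iterate (D : Derivation k (R3 k) (R3 k)) (hD : IsLND D) (p : Fin 3 → k)
    (r : R3 k) (h : ∀ i, eval p ((⇑D)^[i] r) = 0) : flow D hD p r = 0 := by
  ext i; rw [coeff_flow, h]; simp

lemma taylor_flow (D : Derivation k (R3 k) (R3 k)) (hD : IsLND D) (p : Fin 3 → k) (t : k)
    (r : R3 k) : Polynomial.taylor t (flow D hD p r) = flow D hD (flowPt D hD p t) r := by
  have hd : ∀ i, (⇑Polynomial.derivative)^[i] (flow D hD p r) = flow D hD p ((⇑D)^[i] r) := by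
    intro i
    induction i generalizing r with
    | zero => rfl
    | succ n ih => rw [Function.iterate_succ_apply, deriv_flow, ih, Function.iterate_succ_apply]
  ext i
  rw [Polynomial.taylor_coeff, coeff_flow, ← eval_flow, ← hd]
  have hne : (i.factorial : k) ≠ 0 := by exact_mod_cast i.factorial_ne_zero
  rw [eq_div_iff hne]
  have := congrFun (Polynomial.factorial_smul_hasseDeriv (R := k) i) (flow D hD p r)
  rw [← this]
  simp [mul_comm]

lemma eval_flowPt_neg (D : Derivation k (R3 k) (R3 k)) (hD : IsLND D) (p : Fin 3 → k) (t : k) :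
    flowPt D hD (flowPt D hD p t) (-t) = p := by
  funext i
  rw [flowPt, ← taylor_flow, Polynomial.taylor_eval]
  simp [eval_zero_flow]

/-- `p` is a fixed point of the flow -/
def Fixed (D : Derivation k (R3 k) (R3 k)) (p : Fin 3 → k) : Prop := ∀ r, eval p (D r) = 0

lemma Fixed.flow {D : Derivation k (R3 k) (R3 k)} (hD : IsLND D) {p : Fin 3 → k}
    (h : Fixed D p) (r : R3 k) : flow D hD p r = Polynomial.C (eval p r) := by
  ext i
  rw [coeff_flow, Polynomial.coeff_C]
  cases i with
  | zero => simp
  | succ n => rw [Function.iterate_succ_apply', h]; simp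

lemma Fixed.flowPt {D : Derivation k (R3 k) (R3 k)} (hD : IsLND D) {p : Fin 3 → k}
    (h : Fixed D p) (t : k) : flowPt D hD p t = p := by
  funext i; simp [S15.flowPt, h.flow hD]

lemma fixed_of_flowPt {D : Derivation k (R3 k) (R3 k)} (hD : IsLND D) {p : Fin 3 → k} {t : k}
    (h : Fixed D (S15.flowPt D hD p t)) : Fixed D p := by
  have := eval_flowPt_neg D hD p t
  rw [h.flowPt hD] at this
  rwa [this] at h

lemma fixed_iff_X {D : Derivation k (R3 k) (R3 k)} {p : Fin 3 → k}
    (h : ∀ i, eval p (D (X i)) = 0) : Fixed D p := by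
  intro r
  induction r using MvPolynomial.induction_on with
  | C a =>
    have := D.map_algebraMap a
    rw [MvPolynomial.algebraMap_eq] at this
    simp [this]
  | add p q hp hq => simp [hp, hq]
  | mul_X p i hp => simp [hp, h i]

end Flow
end S15

namespace S15

lemma aeval_scale {σ k A : Type*} [Fintype σ] [CommRing k] [CommRing A] [Algebra k A]
    (w : σ → ℕ) (n : ℕ) (φ : MvPolynomial σ k) (h : φ.IsWeightedHomogeneous w n) (c : A)
    (g : σ → A) : aeval (fun i => c ^ w i * g i) φ = c ^ n * aeval g φ := by
  rw [aeval_def, aeval_def, eval₂_eq', eval₂_eq', Finset.mul_sum]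
  refine Finset.sum_congr rfl fun d hd => ?_
  have hw := h (mem_support_iff.mp hd)
  have : ∏ i, (c ^ w i * g i) ^ d i = c ^ n * ∏ i, g i ^ d i := by
    rw [← hw, Finsupp.weight_apply, Finsupp.sum_fintype _ _ (by simp), ← Finset.prod_pow_eq_pow_sum,
      ← Finset.prod_mul_distrib]
    refine Finset.prod_congr rfl fun i _ => ?_
    rw [mul_pow, ← pow_mul, smul_eq_mul, mul_comm (d i)]
  rw [this]; ring

lemma eval_scale {σ k : Type*} [Fintype σ] [CommRing k] 
    (w : σ → ℕ) (n : ℕ) (φ : MvPolynomial σ k) (h : φ.IsWeightedHomogeneous w n) (c : k)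
    (g : σ → k) : eval (fun i => c ^ w i * g i) φ = c ^ n * eval g φ := by
  have := aeval_scale w n φ h c g
  simpa [aeval_eq_eval] using this

variable {k : Type} [Field k] 

lemma exists_combo [IsAlgClosed k] (q : Fin 3 → Polynomial k)
    (h : ∀ t, ∃ i, (q i).eval t ≠ 0) : ∃ a : Fin 3 → Polynomial k, ∑ i, a i * q i = 1 := by
  let I := Ideal.span (Set.range q)
  have hI : I = ⊤ := by
    obtain ⟨g, hg⟩ := (IsPrincipalIdealRing.principal I).principal
    by_contra hne
    have hgd : ∀ i, g ∣ q i := fun i => by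
      rw [← Ideal.mem_span_singleton]
      have : q i ∈ I := Ideal.subset_span ⟨i, rfl⟩
      rw [hg] at this; exact this
    by_cases hdeg : g.degree = 0
    · apply hne
      rw [hg]
      exact Ideal.span_singleton_eq_top.mpr (Polynomial.isUnit_iff_degree_eq_zero.mpr hdeg)
    · obtain ⟨t, ht⟩ := IsAlgClosed.exists_root g hdeg
      obtain ⟨i, hi⟩ := h t
      obtain ⟨c, hc⟩ := hgd i
      apply hi
      rw [hc, Polynomial.eval_mul, ht, zero_mul]
  have h1 : (1 : Polynomial k) ∈ I := by rw [hI]; trivial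
  obtain ⟨a, ha⟩ := (Ideal.mem_span_range_iff_exists_fun).mp h1
  exact ⟨a, ha⟩

lemma val_aux [IsAlgClosed k] {K : Type} [Field K] [Algebra k K] (V : ValuationSubring K)
    (hk : ∀ c : k, algebraMap k K c ∈ V) (τ b : K) (hτ : τ ∈ V) (hb : b ≠ 0)
    (q : Fin 3 → Polynomial k) (h : ∀ t, ∃ i, (q i).eval t ≠ 0) (l : Fin 3 → ℕ)
    (hl : ∀ i, 0 < l i) (hv : ∀ i, b ^ l i * Polynomial.aeval τ (q i) ∈ V) : b ∈ V := by
  rcases V.mem_or_inv_mem b with hb' | hb'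
  · exact hb'
  obtain ⟨a, ha⟩ := exists_combo q h
  have hmem : ∀ p : Polynomial k, Polynomial.aeval τ p ∈ V := by
    intro p
    induction p using Polynomial.induction_on' with
    | add p q hp hq => rw [map_add]; exact V.add_mem _ _ hp hq
    | monomial n c =>
      rw [Polynomial.aeval_monomial]; exact V.mul_mem _ _ (hk c) (pow_mem hτ n)
  have key : b = ∑ i, Polynomial.aeval τ (a i) * ((b⁻¹) ^ (l i - 1) * 
      (b ^ l i * Polynomial.aeval τ (q i))) := by
    have e : ∀ i, (b⁻¹) ^ (l i - 1) * (b ^ l i * Polynomial.aeval τ (q i))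
        = b * Polynomial.aeval τ (q i) := by
      intro i
      obtain ⟨m, hm⟩ := Nat.exists_eq_succ_of_ne_zero (hl i).ne'
      rw [hm, Nat.succ_sub_one, pow_succ, inv_pow]
      field_simp
    calc b = b * Polynomial.aeval τ (∑ i, a i * q i) := by rw [ha]; simp
      _ = _ := by
        rw [map_sum, Finset.mul_sum]
        refine Finset.sum_congr rfl fun i _ => ?_
        rw [e, map_mul]; ring
  rw [key]
  exact sum_mem fun i _ => V.mul_mem _ _ (hmem _) (V.mul_mem _ _ (pow_mem hb' _) (hv i))

lemma integral_of_noCommonZero [IsAlgClosed k] (F : Fin 3 → MvPolynomial (Fin 2) k)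
    (l : Fin 3 → ℕ) (hl : ∀ i, 0 < l i) (hF : ∀ i, (F i).IsHomogeneous (l i))
    (h0 : ∀ v : Fin 2 → k, (∀ i, eval v (F i) = 0) → v = 0) :
    (aeval F : R3 k →ₐ[k] MvPolynomial (Fin 2) k).toRingHom.IsIntegral := by
  let A := MvPolynomial (Fin 2) k
  let K := FractionRing A
  let Φ : R3 k →ₐ[k] A := aeval F
  let ψ : R3 k →+* K := (algebraMap A K).comp Φ.toRingHom
  let s : Set K := Set.range ψ
  have hs : Subring.closure s = ψ.range := by
    have : s = (ψ.range : Set K) := by simp [s]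
    rw [this, Subring.closure_eq]
  have hXne : ∀ i : Fin 2, algebraMap A K (X i) ≠ 0 := fun i => by
    simpa using (X_ne_zero i)
  have hk : ∀ c : k, algebraMap k K c ∈ s := fun c => ⟨C c, by
    simp only [ψ, RingHom.comp_apply]
    have : Φ.toRingHom (C c) = algebraMap k A c := by
      exact Φ.commutes c
    rw [this, ← IsScalarTower.algebraMap_apply]⟩
  have hFs : ∀ i, algebraMap A K (F i) ∈ s := fun i => ⟨X i, by
    simp [ψ, Φ]⟩
  have hX : ∀ j : Fin 2, algebraMap A K (X j) ∈ (integralClosure (Subring.closure s) K).toSubring := by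
    rw [← iInf_valuationSubring_superset]
    suffices H : ∀ V : ValuationSubring K, s ⊆ V.toSubring → ∀ j : Fin 2, algebraMap A K (X j) ∈ V by
      intro j
      rw [Subring.mem_iInf]
      intro V
      exact H V.1 V.2 j
    intro V hV
    have key : ∀ j j' : Fin 2, j ≠ j' → algebraMap A K (X j) / algebraMap A K (X j') ∈ V →
        algebraMap A K (X j') ∈ V := by
      intro j j' hjj hτ
      let u : Fin 2 → Polynomial k := fun i => if i = j then Polynomial.X else 1
      refine val_aux V (fun c => hV (hk c)) _ _ hτ (hXne j') (fun i => aeval u (F i)) ?_ l hl ?_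
      · intro t
        by_contra hcon
        push Not at hcon
        let v : Fin 2 → k := fun i => if i = j then t else 1
        have := h0 v (by
          intro i
          have h2 := hcon i
          have h3 : (Polynomial.aeval t).comp (aeval u) = (aeval v : A →ₐ[k] k) := by
            ext i
            simp only [AlgHom.comp_apply, aeval_X, u, v]
            split_ifs <;> simp
          have h4 := DFunLike.congr_fun h3 (F i)
          simp only [AlgHom.comp_apply, Polynomial.coe_aeval_eq_eval, h2] at h4
          rw [aeval_eq_eval] at h4
          exact h4.symm)
        have h5 := congrFun this j'
        simp [v, hjj.symm] at h5
      · intro i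
        have h3 : ((Polynomial.aeval (algebraMap A K (X j) / algebraMap A K (X j'))).comp (aeval u)
            : A →ₐ[k] K) = aeval (fun i => algebraMap A K (X i) / algebraMap A K (X j')) := by
          apply MvPolynomial.algHom_ext
          intro i
          simp only [AlgHom.comp_apply, aeval_X, u]
          split_ifs with hi
          · simp [hi]
          · have : i = j' := by omega
            subst this
            simp [div_self (hXne i)]
        have h4 := DFunLike.congr_fun h3 (F i)
        simp only [AlgHom.comp_apply] at h4
        rw [h4]
        have := aeval_scale (A := K) 1 (l i) (F i) (hF i) (algebraMap A K (X j'))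
          (fun i => algebraMap A K (X i) / algebraMap A K (X j'))
        rw [← this]
        apply hV
        convert hFs i using 1
        have : (aeval (fun i => algebraMap A K (X i)) : A →ₐ[k] K) = 
            (IsScalarTower.toAlgHom k A K) := by
          ext i; simp; rfl
        have h6 : (aeval (fun i => algebraMap A K (X i)) : A →ₐ[k] K) (F i) = algebraMap A K (F i) :=
          DFunLike.congr_fun this (F i)
        rw [← h6]
        congr 2
        funext i
        simp only [Pi.one_apply, pow_one]
        exact mul_div_cancel₀ _ (hXne j')
    have hmulmem : ∀ j j' : Fin 2, j ≠ j' → algebraMap A K (X j) / algebraMap A K (X j') ∈ V →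
        algebraMap A K (X j) ∈ V := fun j j' h1 h2 => by
      have := V.mul_mem _ _ h2 (key j j' h1 h2)
      rwa [div_mul_cancel₀ _ (hXne j')] at this
    have h01 : (0 : Fin 2) ≠ 1 := by decide
    rcases V.mem_or_inv_mem (algebraMap A K (X 0) / algebraMap A K (X 1)) with h1 | h1
    · intro j
      fin_cases j
      · exact hmulmem 0 1 h01 h1
      · exact key 0 1 h01 h1
    · rw [inv_div] at h1
      intro j
      fin_cases j
      · exact key 1 0 h01.symm h1
      · exact hmulmem 1 0 h01.symm h1
  -- pull back
  have hint : ∀ j : Fin 2, Φ.toRingHom.IsIntegralElem (X j) := by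
    intro j
    have h1 := hX j
    rw [hs] at h1
    obtain ⟨p, hpm, hp⟩ : IsIntegral ψ.range (algebraMap A K (X j)) := h1
    have : (p : Polynomial ψ.range) ∈ Polynomial.lifts ψ.rangeRestrict := by
      rw [Polynomial.mem_lifts]
      exact Polynomial.map_surjective _ ψ.rangeRestrict_surjective p
    obtain ⟨P, hP, -, hPm⟩ := Polynomial.lifts_and_degree_eq_and_monic this hpm
    refine ⟨P, hPm, ?_⟩
    apply IsFractionRing.injective A K
    rw [map_zero, ← hp, ← hP, Polynomial.hom_eval₂, Polynomial.eval₂_map]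
    rfl
  intro a
  change Φ.toRingHom.IsIntegralElem a
  induction a using MvPolynomial.induction_on with
  | C c => 
    have : C c = Φ.toRingHom (C c) := (Φ.commutes c).symm
    rw [this]; exact RingHom.isIntegralElem_map _
  | add p q hp hq => exact RingHom.IsIntegralElem.add _ hp hq
  | mul_X p i hp => exact RingHom.IsIntegralElem.mul _ hp (hint i)

end S15

namespace S15
variable {k : Type} [Field k] [CharZero k]

structure IsParam (D : Derivation k (R3 k) (R3 k)) (hD : IsLND D) (p : Fin 3 → k)
    (F : Fin 3 → MvPolynomial (Fin 2) k) (M : ℕ) : Prop where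
  pos : 0 < M
  hom : ∀ i, (F i).IsHomogeneous (w3 i * M)
  nz : ∀ v : Fin 2 → k, (∀ i, eval v (F i) = 0) → v = 0
  pts : ∀ T S : k, S ≠ 0 → ∃ t, ∀ i, eval ![T, S] (F i) = (S ^ M) ^ (w3 i) * flowPt D hD p t i

lemma w3_pos (i : Fin 3) : 0 < w3 i := by fin_cases i <;> simp [w3]

lemma eval_homogenize_zero (q : Polynomial k) (n : ℕ) :
    eval ![1, 0] (Polynomial.homogenize q n) = q.coeff n := by
  rw [Polynomial.homogenize, map_sum]
  rw [Finset.sum_eq_single (n, 0)]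
  · rw [eval_monomial]; simp
  · rintro ⟨a, b⟩ hab hne
    rw [eval_monomial, Finsupp.prod_fintype _ _ (by simp)]
    have hb : b ≠ 0 := by
      rintro rfl
      apply hne
      simpa using hab
    simp [hb]
  · intro h; simp at h

lemma exists_param (D : Derivation k (R3 k) (R3 k)) (hD : IsLND D) (p : Fin 3 → k)
    (hp : ¬ Fixed D p) (h0 : ∀ t, flowPt D hD p t ≠ 0) : ∃ F M, IsParam D hD p F M := by
  set a : Fin 3 → ℕ := fun i => (flow D hD p (X i)).natDegree with ha
  set M := max (2 * a 0) (max (3 * a 1) (6 * a 2)) with hM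
  set q : Fin 3 → Polynomial k := fun i => Polynomial.expand k 6 (flow D hD p (X i)) with hq
  have hdeg : ∀ i, (q i).natDegree ≤ w3 i * M := by
    intro i
    simp only [hq, Polynomial.natDegree_expand]
    change a i * 6 ≤ _
    fin_cases i <;> simp [w3] <;> omega
  have hMpos : 0 < M := by
    by_contra hcon
    have hz : ∀ i, a i = 0 := by
      intro i; fin_cases i <;> simp <;> omega
    apply hp
    apply fixed_iff_X
    intro i
    have h1 : (flow D hD p (X i)).coeff 1 = 0 :=
      Polynomial.coeff_eq_zero_of_natDegree_lt (by
        have := hz i; simp only [ha] at this; omega)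
    rw [coeff_flow] at h1
    simpa using h1
  have htop : ∃ i, (q i).coeff (w3 i * M) ≠ 0 := by
    have : ∃ i, w3 i * M = a i * 6 := by
      rcases max_choice (2 * a 0) (max (3 * a 1) (6 * a 2)) with h | h
      · exact ⟨0, by simp [w3]; omega⟩
      · rcases max_choice (3 * a 1) (6 * a 2) with h' | h'
        · exact ⟨1, by simp [w3]; omega⟩
        · exact ⟨2, by simp [w3]; omega⟩
    obtain ⟨i, hi⟩ := this
    refine ⟨i, ?_⟩
    rw [hi]
    simp only [hq]
    rw [Polynomial.coeff_expand_mul (by norm_num)]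
    change Polynomial.leadingCoeff _ ≠ 0
    rw [Polynomial.leadingCoeff_ne_zero]
    intro h
    have : a i = 0 := by simp [ha, h]
    rw [this] at hi
    have := Nat.mul_pos (w3_pos i) hMpos
    omega
  have hev : ∀ T S : k, S ≠ 0 → ∀ i, eval ![T, S] (Polynomial.homogenize (q i) (w3 i * M)) =
      (S ^ M) ^ (w3 i) * flowPt D hD p ((T / S) ^ 6) i := by
    intro T S hS i
    have e1 := eval_scale 1 (w3 i * M) _ (Polynomial.isHomogeneous_homogenize (n := w3 i * M) (q i))
      S ![T / S, 1]
    have e2 : (fun i => S ^ (1 : Fin 2 → ℕ) i * ![T / S, 1] i) = ![T, S] := by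
      funext j; fin_cases j
      · simp; field_simp
      · simp
    rw [e2] at e1
    rw [e1, ← pow_mul, mul_comm M]
    congr 1
    have := Polynomial.aeval_homogenize_of_eq_one (hdeg i) (![T / S, 1] : Fin 2 → k) (by simp)
    rw [aeval_eq_eval] at this
    refine this.trans ?_
    simp only [hq, flowPt, Polynomial.coe_aeval_eq_eval]
    rw [Polynomial.expand_eval]
    simp
  refine ⟨fun i => Polynomial.homogenize (q i) (w3 i * M), M, hMpos,
    fun i => Polynomial.isHomogeneous_homogenize _, ?_, fun T S hS => ⟨_, hev T S hS⟩⟩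
  intro v hv
  have hvv : v = ![v 0, v 1] := by funext j; fin_cases j <;> rfl
  by_cases hS : v 1 = 0
  · obtain ⟨i, hi⟩ := htop
    have e1 := eval_scale 1 (w3 i * M) _ (Polynomial.isHomogeneous_homogenize (n := w3 i * M) (q i))
      (v 0) ![1, 0]
    have e2 : (fun i => v 0 ^ (1 : Fin 2 → ℕ) i * ![1, 0] i) = v := by
      funext j; fin_cases j
      · simp
      · simp [hS]
    rw [e2, hv i, eval_homogenize_zero] at e1
    have : v 0 = 0 := by
      by_contra hne
      exact mul_ne_zero (pow_ne_zero _ hne) hi e1.symm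
    funext j; fin_cases j <;> simp [this, hS]
  · exfalso
    apply h0 ((v 0 / v 1) ^ 6)
    funext i
    have := hv i
    rw [hvv, hev _ _ hS] at this
    exact (mul_eq_zero.mp this).resolve_left (pow_ne_zero _ (pow_ne_zero _ hS))

section
variable {D : Derivation k (R3 k) (R3 k)} {hD : IsLND D} {p : Fin 3 → k}
    {F : Fin 3 → MvPolynomial (Fin 2) k} {M : ℕ}

lemma eval_aeval_F (v : Fin 2 → k) (r : R3 k) : 
    eval v (aeval F r) = eval (fun i => eval v (F i)) r := by
  have : (aeval v : _ →ₐ[k] k).comp (aeval F) = aeval (fun i => eval v (F i)) := by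
    ext i; simp [aeval_eq_eval]
  have := DFunLike.congr_fun this r
  simpa [aeval_eq_eval] using this

lemma IsParam.eval_eq (H : IsParam D hD p F M) (r : R3 k) (n : ℕ)
    (hr : r.IsWeightedHomogeneous w3 n) (T S : k) (hS : S ≠ 0) :
    ∃ t, eval ![T, S] (aeval F r) = (S ^ M) ^ n * (flow D hD p r).eval t := by
  obtain ⟨t, ht⟩ := H.pts T S hS
  refine ⟨t, ?_⟩
  rw [eval_aeval_F, eval_flow, ← eval_scale w3 n r hr]
  congr 2
  funext i
  exact ht i

lemma IsParam.aeval_of_const (H : IsParam D hD p F M) (r : R3 k) (n : ℕ)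
    (hr : r.IsWeightedHomogeneous w3 n) (c : k) (hc : flow D hD p r = Polynomial.C c) :
    aeval F r = C c * X 1 ^ (M * n) := by
  have h : X 1 * (aeval F r - C c * X 1 ^ (M * n)) = (0 : MvPolynomial (Fin 2) k) := by
    apply MvPolynomial.funext
    intro v
    have hvv : v = ![v 0, v 1] := by funext j; fin_cases j <;> rfl
    rw [hvv]
    by_cases hS : v 1 = 0
    · simp [hS]
    · obtain ⟨t, ht⟩ := H.eval_eq r n hr (v 0) (v 1) hS
      simp only [map_mul, map_sub, ht, hc]
      simp
      right
      ring
  rcases mul_eq_zero.mp h with h | h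
  · exact absurd h (X_ne_zero _)
  · exact sub_eq_zero.mp h

lemma flow_of_ker (D : Derivation k (R3 k) (R3 k)) (hD : IsLND D) (p : Fin 3 → k)
    (r : R3 k) (h : D r = 0) : flow D hD p r = Polynomial.C (eval p r) := by
  ext i
  rw [coeff_flow, Polynomial.coeff_C]
  cases i with
  | zero => simp
  | succ n => rw [Function.iterate_succ_apply, h, iterate_map_zero D n]; simp

lemma IsParam.limit_zero (H : IsParam D hD p F M) (r : R3 k) (n : ℕ) (hn : 0 < n)
    (hr : r.IsWeightedHomogeneous w3 n) (h : D r = 0) :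
    eval (fun i => eval ![1, 0] (F i)) r = 0 := by
  rw [← eval_aeval_F, H.aeval_of_const r n hr _ (flow_of_ker D hD p r h)]
  have : M * n ≠ 0 := (Nat.mul_pos H.pos hn).ne'
  simp [this]

variable [IsAlgClosed k]

lemma IsParam.integral (H : IsParam D hD p F M) :
    (aeval F : R3 k →ₐ[k] MvPolynomial (Fin 2) k).toRingHom.IsIntegral :=
  integral_of_noCommonZero F _ (fun i => Nat.mul_pos (w3_pos i) H.pos) H.hom H.nz

lemma chain_false (P : Fin 5 → Ideal (R3 k)) [∀ i, (P i).IsPrime] (h : StrictMono P) : False := by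
  have hdim : ringKrullDim (R3 k) = 3 := by
    simp [R3]
  let l : LTSeries (PrimeSpectrum (R3 k)) := 
    { length := 4
      toFun := fun i => ⟨P i, inferInstance⟩
      step := fun i => h (by exact Fin.castSucc_lt_succ) }
  have := Order.LTSeries.length_le_krullDim l
  change _ ≤ ringKrullDim (R3 k) at this
  rw [hdim] at this
  norm_cast at this

lemma IsParam.ker_eq (H : IsParam D hD p F M) (u : R3 k) (n : ℕ) (hu : Prime u)
    (hr : u.IsWeightedHomogeneous w3 n) (h : flow D hD p u = 0) :
    RingHom.ker (aeval F : R3 k →ₐ[k] MvPolynomial (Fin 2) k).toRingHom = Ideal.span {u} := by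
  set Φ := (aeval F : R3 k →ₐ[k] MvPolynomial (Fin 2) k).toRingHom with hΦ
  have hint := H.integral
  have hmem : u ∈ RingHom.ker Φ := by
    rw [RingHom.mem_ker]
    have := H.aeval_of_const u n hr 0 (by simpa using h)
    simpa [hΦ] using this
  have hle : Ideal.span {u} ≤ RingHom.ker Φ := by
    rwa [Ideal.span_singleton_le_iff_mem]
  by_contra hne
  have hlt : Ideal.span {u} < RingHom.ker Φ := lt_of_le_of_ne hle (Ne.symm hne)
  letI := Φ.toAlgebra
  haveI : Algebra.IsIntegral (R3 k) (MvPolynomial (Fin 2) k) := ⟨hint⟩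
  have hX0 : Prime (X 0 : MvPolynomial (Fin 2) k) := MvPolynomial.X_prime
  let I1 : Ideal (MvPolynomial (Fin 2) k) := Ideal.span {X 0}
  haveI : I1.IsPrime := (Ideal.span_singleton_prime (X_ne_zero 0)).mpr hX0
  let I2 : Ideal (MvPolynomial (Fin 2) k) := RingHom.ker (constantCoeff (σ := Fin 2) (R := k))
  haveI : I2.IsPrime := RingHom.ker_isPrime _
  have h01 : (⊥ : Ideal (MvPolynomial (Fin 2) k)) < I1 := by
    rw [bot_lt_iff_ne_bot]
    simp [I1]
  have h12 : I1 < I2 := by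
    refine lt_of_le_of_ne ?_ ?_
    · rw [Ideal.span_singleton_le_iff_mem]
      simp [I2]
    · intro he
      have : (X 1 : MvPolynomial (Fin 2) k) ∈ I1 := by rw [he]; simp [I2]
      rw [Ideal.mem_span_singleton, X_dvd_X] at this
      simp at this
  have k1 : RingHom.ker Φ < I1.comap Φ :=
    Ideal.IsIntegral.comap_lt_comap (R := R3 k) h01
  have k2 : I1.comap Φ < I2.comap Φ :=
    Ideal.IsIntegral.comap_lt_comap (R := R3 k) h12
  let P : Fin 5 → Ideal (R3 k) := 
    ![⊥, Ideal.span {u}, RingHom.ker Φ, I1.comap Φ, I2.comap Φ]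
  haveI : ∀ i, (P i).IsPrime := by
    intro i
    fin_cases i
    · exact Ideal.isPrime_bot
    · exact (Ideal.span_singleton_prime hu.ne_zero).mpr hu
    · exact RingHom.ker_isPrime Φ
    · exact Ideal.IsPrime.comap Φ
    · exact Ideal.IsPrime.comap Φ
  apply chain_false P
  rw [Fin.strictMono_iff_lt_succ]
  intro i
  fin_cases i
  · change (⊥ : Ideal (R3 k)) < Ideal.span {u}
    rw [bot_lt_iff_ne_bot]
    simpa using hu.ne_zero
  · exact hlt
  · exact k1
  · exact k2

lemma IsParam.surj (H : IsParam D hD p F M) (u : R3 k) (n : ℕ) (hu : Prime u)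
    (hr : u.IsWeightedHomogeneous w3 n) (h : flow D hD p u = 0) (Q : Fin 3 → k)
    (hQ : eval Q u = 0) : ∃ T S : k, ∀ i, eval ![T, S] (F i) = Q i := by
  have hker := H.ker_eq u n hu hr h
  have hint := H.integral
  set Φ := (aeval F : R3 k →ₐ[k] MvPolynomial (Fin 2) k).toRingHom with hΦ
  letI := Φ.toAlgebra
  haveI : Algebra.IsIntegral (R3 k) (MvPolynomial (Fin 2) k) := ⟨hint⟩
  let m : Ideal (R3 k) := RingHom.ker (eval Q)
  haveI hm : m.IsMaximal := RingHom.ker_isMaximal_of_surjective _ (fun c => ⟨C c, by simp⟩)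
  have hle : (⊥ : Ideal (MvPolynomial (Fin 2) k)).comap (algebraMap (R3 k) _) ≤ m := by
    change RingHom.ker Φ ≤ m
    rw [hker, Ideal.span_singleton_le_iff_mem]
    exact hQ
  obtain ⟨N, -, hN, hNm⟩ := Ideal.exists_ideal_over_prime_of_isIntegral m _ hle
  haveI : N.IsMaximal := Ideal.isMaximal_of_isIntegral_of_isMaximal_comap N (by rw [hNm]; exact hm)
  obtain ⟨v, hv⟩ := MvPolynomial.eq_vanishingIdeal_singleton_of_isMaximal k this
  refine ⟨v 0, v 1, fun i => ?_⟩
  have hvv : ![v 0, v 1] = v := by funext j; fin_cases j <;> rfl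
  rw [hvv]
  have h1 : (X i - C (Q i) : R3 k) ∈ m := by simp [m, RingHom.mem_ker]
  rw [← hNm, Ideal.mem_comap] at h1
  have h2 : algebraMap (R3 k) (MvPolynomial (Fin 2) k) (X i - C (Q i)) = F i - C (Q i) := by
    change aeval F (X i - C (Q i)) = _
    simp
  rw [h2, hv, mem_vanishingIdeal_singleton_iff] at h1
  simpa [sub_eq_zero, aeval_eq_eval] using h1
end
end S15

namespace S15
variable {k : Type} [Field k]

def lamHom : R3 k →ₐ[k] Polynomial (R3 k) :=
  aeval (fun i => (Polynomial.X : Polynomial (R3 k)) ^ w3 i * Polynomial.C (X i))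

lemma lamHom_monomial (d : Fin 3 →₀ ℕ) (c : k) :
    lamHom (monomial d c) = Polynomial.monomial (Finsupp.weight w3 d) (monomial d c) := by
  have h := aeval_scale w3 _ (monomial d c) (isWeightedHomogeneous_monomial w3 d c rfl)
    (Polynomial.X : Polynomial (R3 k)) (fun i => Polynomial.C (X i))
  have h2 : aeval (fun i => (Polynomial.C (X i) : Polynomial (R3 k))) (monomial d c)
      = Polynomial.C (monomial d c) := by
    have : (aeval (fun i => (Polynomial.C (X i) : Polynomial (R3 k))) : R3 k →ₐ[k] _) =
        Polynomial.CAlgHom := by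
      ext i; simp
    rw [this]; rfl
  rw [lamHom, h, h2, ← Polynomial.C_mul_X_pow_eq_monomial, mul_comm]

lemma coeff_lamHom (u : R3 k) (d : Fin 3 →₀ ℕ) :
    coeff d ((lamHom u).coeff (Finsupp.weight w3 d)) = coeff d u := by
  induction u using MvPolynomial.induction_on' with
  | monomial e c =>
    rw [lamHom_monomial, Polynomial.coeff_monomial]
    split_ifs with h
    · rfl
    · have : e ≠ d := fun h' => h (by rw [h'])
      simp [coeff_monomial, this]
  | add p q hp hq => simp [hp, hq]

lemma lamHom_homog (u : R3 k) (n : ℕ) (hu : u.IsWeightedHomogeneous w3 n) :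
    lamHom u = Polynomial.monomial n u := by
  conv_lhs => rw [u.as_sum]
  conv_rhs => rw [u.as_sum]
  rw [map_sum, map_sum]
  refine Finset.sum_congr rfl fun d hd => ?_
  rw [lamHom_monomial, hu (mem_support_iff.mp hd)]

lemma homog_of_dvd {φ u : R3 k} {n : ℕ} (hφ : φ.IsWeightedHomogeneous w3 n) (h0 : φ ≠ 0)
    (hd : u ∣ φ) : ∃ m, u.IsWeightedHomogeneous w3 m := by
  obtain ⟨v, rfl⟩ := hd
  have hu0 : u ≠ 0 := left_ne_zero_of_mul h0
  have hv0 : v ≠ 0 := right_ne_zero_of_mul h0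
  have hinj : ∀ u : R3 k, u ≠ 0 → lamHom u ≠ 0 := by
    intro u hu h
    apply hu
    ext d
    rw [← coeff_lamHom, h]; simp
  have h1 := lamHom_homog _ n hφ
  rw [map_mul] at h1
  have e1 := congrArg Polynomial.natDegree h1
  have e2 := congrArg Polynomial.natTrailingDegree h1
  rw [Polynomial.natDegree_mul (hinj _ hu0) (hinj _ hv0),
    Polynomial.natDegree_monomial_eq _ h0] at e1
  rw [Polynomial.natTrailingDegree_mul (hinj _ hu0) (hinj _ hv0),
    Polynomial.natTrailingDegree_monomial h0] at e2
  have l1 := Polynomial.natTrailingDegree_le_natDegree (lamHom u)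
  have l2 := Polynomial.natTrailingDegree_le_natDegree (lamHom v)
  refine ⟨(lamHom u).natDegree, ?_⟩
  intro d hd
  rw [← coeff_lamHom] at hd
  have hne : (lamHom u).coeff (Finsupp.weight w3 d) ≠ 0 := by
    intro h; rw [h] at hd; simp at hd
  have a1 := Polynomial.le_natDegree_of_ne_zero hne
  have a2 := Polynomial.natTrailingDegree_le_of_ne_zero hne
  omega

lemma homog_zero_const {φ : R3 k} (hφ : φ.IsWeightedHomogeneous w3 0) : φ = C (coeff 0 φ) := by
  ext d
  rw [coeff_C]
  split_ifs with h
  · rw [h]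
  · by_contra hne
    have := hφ hne
    apply h
    rw [Finsupp.weight_apply, Finsupp.sum_fintype _ _ (by simp)] at this
    simp only [Finset.sum_eq_zero_iff, smul_eq_mul, mul_eq_zero] at this
    ext i
    have h2 := this i (Finset.mem_univ i)
    have := w3_pos i
    simp only [Finsupp.coe_zero, Pi.zero_apply]
    omega

lemma homog_eval_zero {φ : R3 k} {n : ℕ} (hφ : φ.IsWeightedHomogeneous w3 n)
    (h : eval 0 φ ≠ 0) : n = 0 := by
  have : coeff 0 φ ≠ 0 := by
    rwa [← constantCoeff_eq, ← eval_zero]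
  have h2 := hφ this
  simpa using h2.symm

section
variable [CharZero k]
variable {D : Derivation k (R3 k) (R3 k)} 

lemma exists_eval_ne_zero (φ : R3 k) (h : φ ≠ 0) : ∃ p, eval p φ ≠ 0 := by
  by_contra hcon
  push Not at hcon
  exact h (MvPolynomial.funext (fun p => by simpa using hcon p))

lemma fact_closed (hD : IsLND D) {a b : R3 k} (hab : a * b ≠ 0) (h : D (a * b) = 0) : D a = 0 := by
  by_contra hne
  obtain ⟨p, hp⟩ := exists_eval_ne_zero (a * b * D a) (mul_ne_zero hab hne)
  rw [map_mul] at hp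
  have h1 := flow_of_ker D hD p _ h
  rw [map_mul] at h1
  have hu : IsUnit (flow D hD p a) := by
    apply isUnit_of_mul_isUnit_left (y := flow D hD p b)
    rw [h1]
    exact Polynomial.isUnit_C.mpr (isUnit_iff_ne_zero.mpr (left_ne_zero_of_mul hp))
  have h2 := Polynomial.natDegree_eq_zero_of_isUnit hu
  have h3 : (flow D hD p a).coeff 1 = 0 :=
    Polynomial.coeff_eq_zero_of_natDegree_lt (by omega)
  rw [coeff_flow] at h3
  apply right_ne_zero_of_mul hp
  simpa using h3

lemma deriv_formula (δ : Derivation k (R3 k) (R3 k)) (f : R3 k) :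
    δ f = ∑ j, δ (X j) * pderiv j f := by
  have : δ = ∑ j, δ (X j) • pderiv j := by
    apply derivation_ext
    intro i
    rw [Fin.sum_univ_three]
    fin_cases i <;> simp [pderiv_X]
  conv_lhs => rw [this]
  rw [Fin.sum_univ_three, Fin.sum_univ_three]
  simp

lemma homog_D {m : ℤ} (hm : DerivIsHomogOfDeg w3 D m) {r : R3 k} {n : ℕ}
    (hr : r.IsWeightedHomogeneous w3 n) : ∃ j, (D r).IsWeightedHomogeneous w3 j := by
  obtain ⟨h1, h2⟩ := hm n r hr
  by_cases hneg : (n : ℤ) + m < 0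
  · exact ⟨0, by rw [h2 hneg]; exact isWeightedHomogeneous_zero _ _ _⟩
  · obtain ⟨j, hj⟩ := Int.eq_ofNat_of_zero_le (not_lt.mp hneg)
    exact ⟨j, h1 j hj.symm⟩

lemma homog_iter {m : ℤ} (hm : DerivIsHomogOfDeg w3 D m) {r : R3 k} {n : ℕ}
    (hr : r.IsWeightedHomogeneous w3 n) (j : ℕ) :
    (∀ l : ℕ, (l : ℤ) = n + j * m → ((⇑D)^[j] r).IsWeightedHomogeneous w3 l) ∧
    ((n : ℤ) + j * m < 0 → (⇑D)^[j] r = 0) := by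
  induction j with
  | zero =>
    refine ⟨fun l hl => ?_, fun h => ?_⟩
    · have : l = n := by simpa using hl
      subst this; exact hr
    · exfalso; simp at h; omega
  | succ j ih =>
    obtain ⟨h1, h2⟩ := ih
    rw [Function.iterate_succ_apply']
    by_cases hneg : (n : ℤ) + j * m < 0
    · rw [h2 hneg, map_zero]
      exact ⟨fun l _ => isWeightedHomogeneous_zero _ _ _, fun _ => rfl⟩
    · obtain ⟨i, hi⟩ := Int.eq_ofNat_of_zero_le (not_lt.mp hneg)
      obtain ⟨h3, h4⟩ := hm i _ (h1 i hi.symm)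
      refine ⟨fun l hl => h3 l ?_, fun h => h4 ?_⟩
      · rw [hl]; push_cast; rw [add_mul, ← add_assoc, hi]; push_cast; ring
      · push_cast at h; rw [add_mul, ← add_assoc, hi] at h; push_cast at h; linarith

lemma fixed_scale {m : ℤ} (hm : DerivIsHomogOfDeg w3 D m) {p : Fin 3 → k} {c : k} (hc : c ≠ 0)
    (h : Fixed D (fun i => c ^ w3 i * p i)) : Fixed D p := by
  apply fixed_iff_X
  intro i
  obtain ⟨j, hj⟩ := homog_D hm (isWeightedHomogeneous_X k w3 i)
  have := h (X i)
  rw [eval_scale w3 j _ hj] at this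
  exact (mul_eq_zero.mp this).resolve_left (pow_ne_zero _ hc)

lemma orbit_zero (hD : IsLND D) {m : ℤ} (hm : DerivIsHomogOfDeg w3 D m) {t : k}
    (h : flowPt D hD 0 t 2 = 1) : ∃ c, c ≠ 0 ∧ D (X 2) = C c := by
  have hne : flow D hD 0 (X 2) ≠ 0 := by
    intro h0
    rw [flowPt, h0] at h
    simp at h
  have : ∃ j, (flow D hD 0 (X 2)).coeff j ≠ 0 := by
    by_contra hcon
    push Not at hcon
    exact hne (Polynomial.ext (by simpa using hcon))
  obtain ⟨j, hj⟩ := this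
  rw [coeff_flow] at hj
  have hj2 : eval 0 ((⇑D)^[j] (X 2)) ≠ 0 := by
    intro h; rw [h] at hj; simp at hj
  obtain ⟨h1, h2⟩ := homog_iter hm (isWeightedHomogeneous_X k w3 2) j
  have hw : w3 2 = 1 := rfl
  rw [hw] at h1 h2
  have hj0 : j ≠ 0 := by
    rintro rfl
    simp at hj2
  have hnn : ¬ (((1 : ℕ) : ℤ) + j * m < 0) := by
    intro hneg
    rw [h2 hneg] at hj2; simp at hj2
  obtain ⟨l, hl⟩ := Int.eq_ofNat_of_zero_le (not_lt.mp hnn)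
  have h3 := homog_eval_zero (h1 l hl.symm) hj2
  rw [h3] at hl
  have hmul : (j : ℤ) * (-m) = 1 := by push_cast at hl; linarith
  have hj1 : (j : ℤ) = 1 := Int.eq_one_of_mul_eq_one_right (by positivity) hmul
  have hj1' : j = 1 := by exact_mod_cast hj1
  subst hj1'
  have h4 := h1 0 (by rw [hl])
  simp only [Function.iterate_one] at h4 hj2
  refine ⟨coeff 0 (D (X 2)), ?_, homog_zero_const h4⟩
  rwa [← constantCoeff_eq, ← eval_zero]

lemma flow_X2 (hD : IsLND D) {c : k} (h : D (X 2) = C c) (p : Fin 3 → k) (t : k) :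
    flowPt D hD p t 2 = p 2 + c * t := by
  have : flow D hD p (X 2) = Polynomial.C (p 2) + Polynomial.C c * Polynomial.X := by
    ext i
    rw [coeff_flow]
    match i with
    | 0 => simp
    | 1 => simp [h]
    | i + 2 =>
      rw [Function.iterate_succ_apply, Function.iterate_succ_apply, h]
      have h0 : D (C c) = 0 := D.map_algebraMap c
      rw [h0, iterate_map_zero D i]
      simp [Polynomial.coeff_C, Polynomial.coeff_X]
  rw [flowPt, this]; simp

end

structure Sing (f : R3 k) (Q : Fin 3 → k) : Prop where
  z : Q 2 = 1
  f0 : eval Q f = 0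
  df : ∀ j, eval Q (pderiv j f) = 0

section
variable [CharZero k] [IsAlgClosed k]
variable {D : Derivation k (R3 k) (R3 k)} 

lemma Sing.deriv {f : R3 k} {Q : Fin 3 → k} (h : Sing f Q) (δ : Derivation k (R3 k) (R3 k)) :
    eval Q (δ f) = 0 := by
  rw [deriv_formula, map_sum]
  exact Finset.sum_eq_zero fun j _ => by rw [map_mul, h.df, mul_zero]

lemma exists_u (hD : IsLND D) {m : ℤ} (hm : DerivIsHomogOfDeg w3 D m) {f : R3 k}
    (hf : f.IsWeightedHomogeneous w3 9) (hirr : Irreducible f) (hD2 : D (D f) = 0)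
    {Q : Fin 3 → k} (hQ : Sing f Q) : ∃ u n, Prime u ∧ 0 < n ∧ u.IsWeightedHomogeneous w3 n ∧
      D u = 0 ∧ eval Q u = 0 := by
  by_cases h0 : D f = 0
  · exact ⟨f, 9, hirr.prime, by norm_num, hf, h0, hQ.f0⟩
  obtain ⟨s, hs, hass⟩ := UniqueFactorizationMonoid.exists_prime_factors (D f) h0
  have h1 : eval Q s.prod = 0 := by
    obtain ⟨e, he⟩ := hass.symm
    rw [← he, map_mul, hQ.deriv D, zero_mul]
  rw [← Multiset.prod_hom, Multiset.prod_eq_zero_iff, Multiset.mem_map] at h1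
  obtain ⟨u, hu, hu0⟩ := h1
  have hdvd : u ∣ D f := (Multiset.dvd_prod hu).trans hass.dvd
  obtain ⟨j, hj⟩ := homog_D hm hf
  obtain ⟨n, hn⟩ := homog_of_dvd hj h0 hdvd
  obtain ⟨v, hv⟩ := hdvd
  have hDu : D u = 0 := fact_closed hD (a := u) (b := v) (by rwa [← hv]) (by rw [← hv, hD2])
  refine ⟨u, n, hs u hu, Nat.pos_of_ne_zero ?_, hn, hDu, hu0⟩
  rintro rfl
  rw [homog_zero_const hn] at hu0
  apply (hs u hu).ne_zero
  rw [homog_zero_const hn]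
  simp only [eval_C] at hu0
  rw [hu0, C_0]

lemma jac_stable {f : R3 k} (hDf : D f = 0) {Q : Fin 3 → k} (hQ : Sing f Q) (i : ℕ) (j : Fin 3) :
    eval Q ((⇑D)^[i] (pderiv j f)) = 0 := by
  let J : Ideal (R3 k) := Ideal.span (Set.range fun j => pderiv j f)
  have hδ : ∀ δ : Derivation k (R3 k) (R3 k), δ f ∈ J := by
    intro δ
    rw [deriv_formula]
    exact sum_mem fun j _ => J.mul_mem_left _ (Ideal.subset_span ⟨j, rfl⟩)
  have hDJ : ∀ r ∈ J, D r ∈ J := by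
    intro r hr
    refine Submodule.span_induction (p := fun r _ => D r ∈ J) ?_ ?_ ?_ ?_ hr
    · rintro _ ⟨j, rfl⟩
      have h1 : D (pderiv j f) = ⁅D, pderiv j⁆ f := by
        rw [Derivation.commutator_apply, hDf]; simp
      change D (pderiv j f) ∈ J
      rw [h1]
      exact hδ _
    · simp
    · intro x y _ _ hx hy
      rw [map_add]; exact J.add_mem hx hy
    · intro a x hx hDx
      rw [smul_eq_mul, Derivation.leibniz]
      exact J.add_mem (J.mul_mem_left _ hDx) (by
        rw [smul_eq_mul]; exact J.mul_mem_right _ hx)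
  have hit : ∀ i, (⇑D)^[i] (pderiv j f) ∈ J := by
    intro i
    induction i with
    | zero => exact Ideal.subset_span ⟨j, rfl⟩
    | succ n ih => rw [Function.iterate_succ_apply']; exact hDJ _ ih
  have hJ : J ≤ RingHom.ker (eval Q) := by
    rw [Ideal.span_le]
    rintro _ ⟨j, rfl⟩
    exact hQ.df j
  exact hJ (hit i)

lemma eval_C3 {f : R3 k} {p q : k}
    (h : aeval ![X 0, X 1, 0] f = (X 0 * (C p * X 0 ^ 2 + C q * X 1 ^ 3) : MvPolynomial ℕ k)) 
    (x y : k) :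
    eval ![x, y, 0] f = x * (p * x ^ 2 + q * y ^ 3) := by
  let v : ℕ → k := fun i => if i = 0 then x else y
  have h2 : (aeval v : MvPolynomial ℕ k →ₐ[k] k).comp (aeval ![X 0, X 1, 0]) 
      = aeval ![x, y, 0] := by
    ext i
    fin_cases i <;> simp [v]
  have h3 := DFunLike.congr_fun h2 f
  rw [AlgHom.comp_apply, h] at h3
  rw [aeval_eq_eval] at h3
  have : eval ![x, y, 0] f = _ := h3.symm
  rw [this]
  simp [v]

lemma pderiv_ne_zero {f : R3 k} (hf : f.IsWeightedHomogeneous w3 9) (h3 : CondC3 k f) :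
    pderiv 0 f ≠ 0 := by
  obtain ⟨p, q, hp, hq, h⟩ := h3
  intro h0
  have hE := hf.sum_weight_X_mul_pderiv
  rw [Fin.sum_univ_three, h0, mul_zero, smul_zero, zero_add] at hE
  have hE2 := congrArg (eval (![1, 0, 0] : Fin 3 → k)) hE
  have hv := eval_C3 h 1 0
  rw [nsmul_eq_mul, nsmul_eq_mul, nsmul_eq_mul, map_add, map_mul, map_mul, map_mul, map_mul, 
    map_mul, eval_X, eval_X, hv] at hE2
  have e1 : (![1, 0, 0] : Fin 3 → k) 1 = 0 := rfl
  have e2 : (![1, 0, 0] : Fin 3 → k) 2 = 0 := rfl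
  rw [e1, e2, zero_mul, zero_mul, mul_zero, mul_zero, add_zero] at hE2
  apply hp
  have e3 : eval (![1, 0, 0] : Fin 3 → k) ((9 : ℕ) : R3 k) = 9 := by simp
  rw [e3] at hE2
  have : (9 : k) * p = 0 := by
    rw [hE2]; ring
  exact (mul_eq_zero.mp this).resolve_left (by norm_num)

lemma claimB (hD : IsLND D) {m : ℤ} (hm : DerivIsHomogOfDeg w3 D m) {f : R3 k}
    (hf : f.IsWeightedHomogeneous w3 9) (hirr : Irreducible f) (h3 : CondC3 k f)
    (hD2 : D (D f) = 0)
    {Q : Fin 3 → k} (hQ : Sing f Q) (hfix : ¬ Fixed D Q) : ∃ t, flowPt D hD Q t = 0 := by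
  by_contra hcon
  push Not at hcon
  obtain ⟨F, M, H⟩ := exists_param D hD Q hfix hcon
  have hff : flow D hD Q f = 0 := by
    apply flow_eq_zero_of_iterate
    intro i
    match i with
    | 0 => exact hQ.f0
    | 1 => exact hQ.deriv D
    | i + 2 => 
      rw [Function.iterate_succ_apply, Function.iterate_succ_apply, hD2, iterate_map_zero D i]
      simp
  have hkf := H.ker_eq f 9 hirr.prime hf hff
  obtain ⟨u, n, hu, hn, huh, hDu, hu0⟩ := exists_u hD hm hf hirr hD2 hQ
  have hku := H.ker_eq u n hu huh (by rw [flow_of_ker D hD Q u hDu, hu0, Polynomial.C_0])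
  have hDf : D f = 0 := by
    have : u ∈ Ideal.span {f} := by
      rw [← hkf, hku]; exact Ideal.mem_span_singleton_self u
    obtain ⟨v, hv⟩ := Ideal.mem_span_singleton.mp this
    exact fact_closed hD (a := f) (b := v) (by rw [← hv]; exact hu.ne_zero) (by rw [← hv, hDu])
  have hph : (pderiv 0 f).IsWeightedHomogeneous w3 6 := hf.pderiv rfl
  have h6 := H.aeval_of_const (pderiv 0 f) 6 hph 0
    (by rw [Polynomial.C_0]; exact flow_eq_zero_of_iterate D hD Q _ (fun i => jac_stable hDf hQ i 0))
  have : pderiv 0 f ∈ Ideal.span {f} := by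
    rw [← hkf, RingHom.mem_ker]
    change aeval F (pderiv 0 f) = 0
    rw [h6]; simp
  obtain ⟨v, hv⟩ := Ideal.mem_span_singleton.mp this
  have hne := pderiv_ne_zero hf h3
  obtain ⟨l, hl⟩ := homog_of_dvd hph hne ⟨f, by rw [hv, mul_comm]⟩
  have := IsWeightedHomogeneous.inj_right hne hph (by rw [hv]; exact hf.mul hl)
  omega

lemma exists_nonfixed (hirrD : IsIrreducibleDeriv D) {u : R3 k} (hu : Prime u) :
    ∃ p, eval p u = 0 ∧ ¬ Fixed D p := by
  by_contra hcon
  push Not at hcon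
  apply hu.not_unit
  apply hirrD
  intro r
  have hp : (Ideal.span {u}).IsPrime := (Ideal.span_singleton_prime hu.ne_zero).mpr hu
  rw [← hp.radical, ← vanishingIdeal_zeroLocus_eq_radical (K := k)]
  rw [mem_vanishingIdeal_iff]
  intro x hx
  rw [mem_zeroLocus_iff] at hx
  have h1 := hx u (Ideal.mem_span_singleton_self u)
  rw [aeval_eq_eval] at h1 ⊢
  exact hcon x h1 r

lemma IsParam.limit_ne_zero {hD : IsLND D} {p : Fin 3 → k}
    {F : Fin 3 → MvPolynomial (Fin 2) k} {M : ℕ} (H : IsParam D hD p F M) :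
    (fun i => eval ![1, 0] (F i)) ≠ 0 := by
  intro h
  have := H.nz ![1, 0] (fun i => congrFun h i)
  have := congrFun this 0
  simp at this

lemma claimA {hD : IsLND D} {m : ℤ} (hm : DerivIsHomogOfDeg w3 D m) 
    {p : Fin 3 → k} (hp : ¬ Fixed D p)
    {F : Fin 3 → MvPolynomial (Fin 2) k} {M : ℕ} (H : IsParam D hD p F M)
    {u : R3 k} {n : ℕ} (hu : Prime u)
    (huh : u.IsWeightedHomogeneous w3 n) (hDu : D u = 0) (hup : eval p u = 0)
    {Q : Fin 3 → k} (hQ : Q ≠ 0) (hQu : eval Q u = 0) (hQf : Fixed D Q) :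
    ∃ c : k, c ≠ 0 ∧ ∀ i, Q i = c ^ w3 i * eval ![1, 0] (F i) := by
  obtain ⟨T, S, hTS⟩ := H.surj u n hu huh
    (by rw [flow_of_ker D hD p u hDu, hup, Polynomial.C_0]) Q hQu
  by_cases hS : S = 0
  · subst hS
    have key : ∀ i, Q i = (T ^ M) ^ w3 i * eval ![1, 0] (F i) := by
      intro i
      have e1 := eval_scale 1 (w3 i * M) _ (H.hom i) T ![1, 0]
      have e2 : (fun i => T ^ (1 : Fin 2 → ℕ) i * ![1, 0] i) = ![T, 0] := by
        funext j; fin_cases j <;> simp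
      rw [e2, hTS] at e1
      rw [e1, ← pow_mul, mul_comm M]
    refine ⟨T ^ M, ?_, key⟩
    intro h0
    apply hQ
    funext i
    rw [key, h0, zero_pow (w3_pos i).ne']; simp
  · exfalso
    obtain ⟨t, ht⟩ := H.pts T S hS
    apply hp
    apply fixed_of_flowPt hD (t := t)
    apply fixed_scale hm (c := S ^ M) (pow_ne_zero _ hS)
    convert hQf using 1
    funext i
    rw [← ht, hTS]

lemma scale_eq {Q1 Q2 P : Fin 3 → k} (h1 : Q1 2 = 1) (h2 : Q2 2 = 1) {c1 c2 : k}
    (e1 : ∀ i, Q1 i = c1 ^ w3 i * P i) (e2 : ∀ i, Q2 i = c2 ^ w3 i * P i) : Q1 = Q2 := by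
  have a1 := e1 2
  have a2 := e2 2
  rw [h1] at a1
  rw [h2] at a2
  have hw : w3 2 = 1 := rfl
  rw [hw, pow_one] at a1 a2
  have : c1 = c2 := by
    have hP : P 2 ≠ 0 := by intro h; rw [h] at a1; simp at a1
    exact mul_right_cancel₀ hP (a1.symm.trans a2)
  funext i
  rw [e1, e2, this]

theorem no_two (hD : IsLND D) (hirrD : IsIrreducibleDeriv D)
    {m : ℤ} (hm : DerivIsHomogOfDeg w3 D m) {f : R3 k}
    (hf : f.IsWeightedHomogeneous w3 9) (hirr : Irreducible f) (h3 : CondC3 k f)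
    (hD2 : D (D f) = 0)
    {Q1 Q2 : Fin 3 → k} (hQ1 : Sing f Q1) (hQ2 : Sing f Q2) : Q1 = Q2 := by
  have horb : ∀ {Q : Fin 3 → k}, Sing f Q → ¬ Fixed D Q → ∃ t c, Q = flowPt D hD 0 t ∧ c ≠ 0 ∧
      D (X 2) = C c ∧ c * t = 1 := by
    intro Q hQ hfix
    obtain ⟨t, ht⟩ := claimB hD hm hf hirr h3 hD2 hQ hfix
    have h1 := eval_flowPt_neg D hD Q t
    rw [ht] at h1
    obtain ⟨c, hc, hc2⟩ := orbit_zero hD hm (t := -t) (by rw [h1]; exact hQ.z)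
    refine ⟨-t, c, h1.symm, hc, hc2, ?_⟩
    have := flow_X2 hD hc2 0 (-t)
    rw [h1, hQ.z] at this
    simpa using this.symm
  by_cases f1 : Fixed D Q1
  swap
  · obtain ⟨t1, c1, e1, hc1, hz1, ht1⟩ := horb hQ1 f1
    by_cases f2 : Fixed D Q2
    · exfalso
      have := f2 (X 2)
      rw [hz1] at this
      simp at this
      exact hc1 this
    · obtain ⟨t2, c2, e2, hc2, hz2, ht2⟩ := horb hQ2 f2
      have hcc : c1 = c2 := C_injective _ _ (hz1.symm.trans hz2)
      subst hcc
      have : t1 = t2 := mul_left_cancel₀ hc1 (ht1.trans ht2.symm)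
      rw [e1, e2, this]
  by_cases f2 : Fixed D Q2
  swap
  · obtain ⟨t2, c2, e2, hc2, hz2, ht2⟩ := horb hQ2 f2
    exfalso
    have := f1 (X 2)
    rw [hz2] at this
    simp at this
    exact hc2 this
  -- both fixed
  have h0 : Fixed D 0 := by
    apply fixed_iff_X
    intro i
    by_contra hne
    obtain ⟨j, hj⟩ := homog_D hm (isWeightedHomogeneous_X k w3 i)
    have hj0 := homog_eval_zero hj hne
    subst hj0
    have h1 := f1 (X i)
    rw [homog_zero_const hj] at h1 hne
    simp only [eval_C] at h1 hne
    exact hne h1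
  have hpar : ∀ p, ¬ Fixed D p → ∃ F M, IsParam D hD p F M := by
    intro p hp
    refine exists_param D hD p hp (fun t ht => hp ?_)
    exact fixed_of_flowPt hD (t := t) (by rw [ht]; exact h0)
  have n1 : Q1 ≠ 0 := fun h => by have := hQ1.z; rw [h] at this; simp at this
  have n2 : Q2 ≠ 0 := fun h => by have := hQ2.z; rw [h] at this; simp at this
  obtain ⟨u1, m1, hu1, hm1, hh1, hDu1, hu01⟩ := exists_u hD hm hf hirr hD2 hQ1
  obtain ⟨u2, m2, hu2, hm2, hh2, hDu2, hu02⟩ := exists_u hD hm hf hirr hD2 hQ2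
  obtain ⟨p1, hp1, hp1f⟩ := exists_nonfixed hirrD hu1
  obtain ⟨p2, hp2, hp2f⟩ := exists_nonfixed hirrD hu2
  obtain ⟨F1, M1, H1⟩ := hpar p1 hp1f
  obtain ⟨F2, M2, H2⟩ := hpar p2 hp2f
  obtain ⟨c1, hc1, e1⟩ := claimA hm hp1f H1 hu1 hh1 hDu1 hp1 n1 hu01 f1
  have hP1 := H1.limit_zero u1 m1 hm1 hh1 hDu1
  have hP2 := H1.limit_zero u2 m2 hm2 hh2 hDu2
  by_cases hPf : Fixed D (fun i => eval ![1, 0] (F1 i))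
  · obtain ⟨c2, hc2, e2⟩ := claimA hm hp2f H2 hu2 hh2 hDu2 hp2 n2 hu02 f2
    obtain ⟨c, hc, e⟩ := claimA hm hp2f H2 hu2 hh2 hDu2 hp2 H1.limit_ne_zero hP2 hPf
    refine scale_eq hQ1.z hQ2.z (P := fun i => eval ![1, 0] (F2 i)) (c1 := c1 * c) ?_ e2
    intro i
    rw [e1 i]
    have he : eval ![1, 0] (F1 i) = c ^ w3 i * eval ![1, 0] (F2 i) := e i
    rw [he, mul_pow, mul_assoc]
  · obtain ⟨F, M, H⟩ := hpar _ hPf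
    have k1 := H.ker_eq u1 m1 hu1 hh1 (by rw [flow_of_ker D hD _ u1 hDu1, hP1, Polynomial.C_0])
    have k2 := H.ker_eq u2 m2 hu2 hh2 (by rw [flow_of_ker D hD _ u2 hDu2, hP2, Polynomial.C_0])
    have hQ21 : eval Q2 u1 = 0 := by
      have : u1 ∈ Ideal.span {u2} := by
        rw [← k2, k1]; exact Ideal.mem_span_singleton_self u1
      obtain ⟨v, hv⟩ := Ideal.mem_span_singleton.mp this
      rw [hv, map_mul, hu02, zero_mul]
    obtain ⟨c2, hc2, e2⟩ := claimA hm hp1f H1 hu1 hh1 hDu1 hp1 n2 hQ21 f2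
    exact scale_eq hQ1.z hQ2.z (P := fun i => eval ![1, 0] (F1 i)) e1 e2
end
end S15

namespace S15

lemma reg_of_principal (O : Type*) [CommRing O] [IsDomain O] [IsLocalRing O] [IsNoetherianRing O]
    (π : O) (h : IsLocalRing.maximalIdeal O = Ideal.span {π}) : IsRegLocalRing O := by
  classical
  refine ⟨inferInstance, inferInstance, ?_⟩
  rw [IsLocalRing.jacobson_eq_maximalIdeal ⊥ bot_ne_top]
  by_cases hπ : π = 0
  · subst hπ
    have hF : IsField O := IsLocalRing.isField_iff_maximalIdeal_eq.mpr (by simpa using h)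
    refine ⟨∅, by simp [h], ?_⟩
    rw [ringKrullDim_eq_zero_of_isField hF]; simp; rfl
  · have hF : ¬ IsField O := by
      rw [IsLocalRing.isField_iff_maximalIdeal_eq, h]; simpa using hπ
    have hpr : (IsLocalRing.maximalIdeal O).IsPrincipal := ⟨π, h⟩
    have hP : IsPrincipalIdealRing O :=
      ((tfae_of_isNoetherianRing_of_isLocalRing_of_isDomain O).out 0 4).mpr hpr
    refine ⟨{π}, by simp [h], ?_⟩
    rw [IsPrincipalIdealRing.ringKrullDim_eq_one O hF]; simp; rfl

lemma reg_equiv {O O' : Type*} [CommRing O] [CommRing O'] (e : O ≃+* O') (h : IsRegLocalRing O) :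
    IsRegLocalRing O' := by
  classical
  obtain ⟨h1, h2, s, hs, hc⟩ := h
  have hN : IsNoetherianRing O' := isNoetherianRing_of_ringEquiv O e
  have hL : IsLocalRing O' := e.isLocalRing
  refine ⟨hN, hL, s.image e, ?_, ?_⟩
  · rw [IsLocalRing.jacobson_eq_maximalIdeal ⊥ bot_ne_top] at hs ⊢
    rw [Finset.coe_image]
    have h3 : Ideal.map e (Ideal.span (s : Set O)) = Ideal.span (e '' s) := Ideal.map_span _ _
    rw [← h3, hs]
    ext x
    obtain ⟨y, rfl⟩ := e.surjective x
    rw [Ideal.mem_map_of_equiv]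
    constructor
    · rintro ⟨z, hz, hzy⟩
      rw [← hzy]
      rw [IsLocalRing.mem_maximalIdeal] at hz ⊢
      simpa [mem_nonunits_iff] using hz
    · intro hy
      refine ⟨y, ?_, rfl⟩
      rw [IsLocalRing.mem_maximalIdeal] at hy ⊢
      simpa [mem_nonunits_iff] using hy
  · rw [Finset.card_image_of_injective _ e.injective, hc, ringKrullDim_eq_of_ringEquiv e]

lemma ideal_eq_map {A O : Type*} [CommRing A] [CommRing O] (θ : A →+* O)
    (h : ∀ o, ∃ a b, IsUnit (θ b) ∧ o * θ b = θ a) (I : Ideal O) : (I.comap θ).map θ = I := by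
  apply le_antisymm Ideal.map_comap_le
  intro o ho
  obtain ⟨a, b, hb, hab⟩ := h o
  have : θ a ∈ (I.comap θ).map θ := Ideal.mem_map_of_mem _ (by
    rw [Ideal.mem_comap, ← hab]; exact I.mul_mem_right _ ho)
  rw [← hab] at this
  exact (Ideal.mul_unit_mem_iff_mem _ hb).mp this

lemma noeth_of_chart {A O : Type*} [CommRing A] [IsNoetherianRing A] [CommRing O] (θ : A →+* O)
    (h : ∀ o, ∃ a b, IsUnit (θ b) ∧ o * θ b = θ a) : IsNoetherianRing O := by
  rw [isNoetherianRing_iff_ideal_fg]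
  intro I
  rw [← ideal_eq_map θ h I]
  exact Ideal.FG.map (IsNoetherian.noetherian _) θ

lemma sub_eval_mem {σ k : Type*} [CommRing k] (v : σ → k) (T : MvPolynomial σ k) :
    T - C (eval v T) ∈ Ideal.span (Set.range fun i => (X i - C (v i) : MvPolynomial σ k)) := by
  induction T using MvPolynomial.induction_on with
  | C a => simp
  | add p q hp hq =>
    have := Ideal.add_mem _ hp hq
    convert this using 1
    simp; ring
  | mul_X p i hp =>
    have h1 := Ideal.mul_mem_right (X i) _ hp
    have h2 := Ideal.mul_mem_left (Ideal.span (Set.range fun i => (X i - C (v i) : MvPolynomial σ k)))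
      (C (eval v p)) (Ideal.subset_span ⟨i, rfl⟩)
    have := Ideal.add_mem _ h1 h2
    convert this using 1
    simp; ring

variable {k : Type} [Field k] 

lemma prime_eq_span {σ : Type*} (v : σ → k) (q : Ideal (MvPolynomial σ k)) (hq : q ≠ ⊤)
    (h : ∀ i, X i - C (v i) ∈ q) :
    q = Ideal.span (Set.range fun i => (X i - C (v i) : MvPolynomial σ k)) := by
  have hle : Ideal.span (Set.range fun i => (X i - C (v i) : MvPolynomial σ k)) ≤ q := by
    rw [Ideal.span_le]; rintro _ ⟨i, rfl⟩; exact h i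
  apply le_antisymm _ hle
  intro T hT
  have h1 := sub_eval_mem v T
  have h2 : C (eval v T) ∈ q := by
    have := q.sub_mem hT (hle h1)
    simpa using this
  have h3 : eval v T = 0 := by
    by_contra hne
    exact hq (Ideal.eq_top_of_isUnit_mem _ h2 ((isUnit_iff_ne_zero.mpr hne).map C))
  rw [h3] at h1
  simpa using h1

lemma nonmax_principal (q : Ideal (MvPolynomial (Fin 2) k)) [hq : q.IsPrime] (hm : ¬ q.IsMaximal) :
    ∃ u, q = Ideal.span {u} := by
  by_cases h0 : q = ⊥
  · exact ⟨0, by simp [h0]⟩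
  obtain ⟨u, huq, hu⟩ := hq.exists_mem_prime_of_ne_bot h0
  refine ⟨u, ?_⟩
  by_contra hne
  have hle : Ideal.span {u} ≤ q := by rwa [Ideal.span_singleton_le_iff_mem]
  obtain ⟨m, hmm, hqm⟩ := Ideal.exists_le_maximal q hq.ne_top
  have hlt : q < m := lt_of_le_of_ne hqm (fun h => hm (h ▸ hmm))
  have hdim : ringKrullDim (MvPolynomial (Fin 2) k) = 2 := by simp
  let P : Fin 4 → Ideal (MvPolynomial (Fin 2) k) := ![⊥, Ideal.span {u}, q, m]
  have hP : ∀ i, (P i).IsPrime := by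
    intro i
    fin_cases i
    · exact Ideal.isPrime_bot
    · exact (Ideal.span_singleton_prime hu.ne_zero).mpr hu
    · exact hq
    · exact hmm.isPrime
  have hmono : StrictMono P := by
    rw [Fin.strictMono_iff_lt_succ]
    intro i
    fin_cases i
    · change (⊥ : Ideal (MvPolynomial (Fin 2) k)) < Ideal.span {u}
      rw [bot_lt_iff_ne_bot]
      simpa using hu.ne_zero
    · exact lt_of_le_of_ne hle (Ne.symm hne)
    · exact hlt
  let l : LTSeries (PrimeSpectrum (MvPolynomial (Fin 2) k)) := 
    { length := 3
      toFun := fun i => ⟨P i, hP i⟩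
      step := fun i => hmono (by exact Fin.castSucc_lt_succ) }
  have := Order.LTSeries.length_le_krullDim l
  change _ ≤ ringKrullDim (MvPolynomial (Fin 2) k) at this
  rw [hdim] at this
  norm_cast at this

/-- abstract description of the local ring of `Proj` at `P` -/
structure LocData (f : R3 k) (P : Ideal (R3 k)) (O L : Type) [CommRing O] [CommRing L]
    [Algebra k O] [Algebra k L] (ι : O →ₐ[k] L) (γ : R3 k →ₐ[k] L) : Prop where
  inj : Function.Injective ι
  f0 : γ f = 0
  ker : ∀ r, γ r = 0 → r ∈ P
  rep : ∀ o, ∃ (n : ℕ) (r s : R3 k), r.IsWeightedHomogeneous w3 n ∧ s.IsWeightedHomogeneous w3 n ∧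
    s ∉ P ∧ ι o * γ s = γ r
  frac : ∀ (n : ℕ) (r s : R3 k), r.IsWeightedHomogeneous w3 n → s.IsWeightedHomogeneous w3 n →
    s ∉ P → ∃ o, ι o * γ s = γ r

section
variable {f : R3 k} {P : Ideal (R3 k)} [hP : P.IsPrime] {O L : Type} [CommRing O] [IsDomain O] 
  [IsLocalRing O] [CommRing L] [IsDomain L] [Algebra k O] [Algebra k L] {ι : O →ₐ[k] L} 
  {γ : R3 k →ₐ[k] L}

lemma LocData.ne (H : LocData f P O L ι γ) {s : R3 k} (hs : s ∉ P) : γ s ≠ 0 :=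
  fun h => hs (H.ker s h)

lemma LocData.unit_iff (H : LocData f P O L ι γ) {n : ℕ} {r s : R3 k}
    (hr : r.IsWeightedHomogeneous w3 n) (hs : s.IsWeightedHomogeneous w3 n) (hsP : s ∉ P) {o : O}
    (ho : ι o * γ s = γ r) : IsUnit o ↔ r ∉ P := by
  constructor
  · intro hu hrP
    obtain ⟨o', ho'⟩ := hu.exists_right_inv
    obtain ⟨n', r', s', hr', hs', hsP', h'⟩ := H.rep o'
    have : γ (r * r' - s * s') = 0 := by
      rw [map_sub, map_mul, map_mul, ← ho, ← h']
      have h1 : ι o * ι o' = 1 := by rw [← map_mul, ho', map_one]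
      linear_combination (γ s * γ s') * h1
    have h2 := H.ker _ this
    have h3 : s * s' ∈ P := by
      have := P.sub_mem (P.mul_mem_right r' hrP) h2
      simpa using this
    rcases hP.mem_or_mem h3 with h | h
    · exact hsP h
    · exact hsP' h
  · intro hrP
    obtain ⟨o', ho'⟩ := H.frac n s r hs hr hrP
    refine IsUnit.of_mul_eq_one o' ?_
    apply H.inj
    apply mul_right_cancel₀ (mul_ne_zero (H.ne hsP) (H.ne hrP))
    rw [map_mul, map_one]
    linear_combination (ι o' * γ r) * ho + γ r * ho'

lemma LocData.mem_iff (H : LocData f P O L ι γ) {n : ℕ} {r s : R3 k}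
    (hr : r.IsWeightedHomogeneous w3 n) (hs : s.IsWeightedHomogeneous w3 n) (hsP : s ∉ P) {o : O}
    (ho : ι o * γ s = γ r) : o ∈ IsLocalRing.maximalIdeal O ↔ r ∈ P := by
  rw [IsLocalRing.mem_maximalIdeal, mem_nonunits_iff, H.unit_iff hr hs hsP ho, not_not]

end
end S15

namespace S15
section
variable {k : Type} [Field k] 

/-- dehomogenization at `z = 1` -/
def dh : R3 k →ₐ[k] MvPolynomial (Fin 2) k := aeval ![X 0, X 1, 1]

lemma eval_dh (a b : k) (r : R3 k) : eval ![a, b] (dh r) = eval ![a, b, 1] r := by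
  induction r using MvPolynomial.induction_on with
  | C a => simp [dh]
  | add p q hp hq => simp [hp, hq]
  | mul_X p i hp =>
    simp only [map_mul, hp, eval_X]
    congr 1
    fin_cases i <;> simp [dh]

lemma pderiv0_dh (r : R3 k) : pderiv 0 (dh r) = dh (pderiv 0 r) := by
  induction r using MvPolynomial.induction_on with
  | C a => simp [dh]
  | add p q hp hq => simp [hp, hq]
  | mul_X p i hp =>
    simp only [map_mul, Derivation.leibniz, hp, map_add, smul_eq_mul]
    fin_cases i <;> simp [dh, pderiv_X]

lemma pderiv1_dh (r : R3 k) : pderiv 1 (dh r) = dh (pderiv 1 r) := by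
  induction r using MvPolynomial.induction_on with
  | C a => simp [dh]
  | add p q hp hq => simp [hp, hq]
  | mul_X p i hp =>
    simp only [map_mul, Derivation.leibniz, hp, map_add, smul_eq_mul]
    fin_cases i <;> simp [dh, pderiv_X]

variable {f : R3 k} {P : Ideal (R3 k)} [hP : P.IsPrime] {O L : Type} [CommRing O] [IsDomain O] 
  [IsLocalRing O] [CommRing L] [IsDomain L] [Algebra k O] [Algebra k L] {ι : O →ₐ[k] L} 
  {γ : R3 k →ₐ[k] L}

lemma homX (i : Fin 3) : (X i : R3 k).IsWeightedHomogeneous w3 (w3 i) :=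
  isWeightedHomogeneous_X k w3 i

lemma homX0 : (X 0 : R3 k).IsWeightedHomogeneous w3 3 := homX 0
lemma homX1 : (X 1 : R3 k).IsWeightedHomogeneous w3 2 := homX 1
lemma homX2 : (X 2 : R3 k).IsWeightedHomogeneous w3 1 := homX 2

lemma LocData.zchart0 (H : LocData f P O L ι γ) (hz : (X 2 : R3 k) ∉ P) :
    ∃ θ : MvPolynomial (Fin 2) k →ₐ[k] O, ∀ n (r : R3 k), r.IsWeightedHomogeneous w3 n →
      ι (θ (dh r)) * γ (X 2 ^ n) = γ r := by
  have hzn : ∀ n, (X 2 : R3 k) ^ n ∉ P := fun n h => hz (hP.mem_of_pow_mem n h)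
  obtain ⟨xi, hx⟩ := H.frac 3 (X 0) (X 2 ^ 3) homX0 (by simpa using homX2.pow 3) (hzn 3)
  obtain ⟨yi, hy⟩ := H.frac 2 (X 1) (X 2 ^ 2) homX1 (by simpa using homX2.pow 2) (hzn 2)
  refine ⟨aeval ![xi, yi], fun n r hr => ?_⟩
  have h1 := aeval_scale w3 n r hr (γ (X 2)) (![ι xi, ι yi, 1])
  have h2 : (ι.comp ((aeval ![xi, yi]).comp dh)) = aeval ![ι xi, ι yi, 1] := by
    ext i; fin_cases i <;> simp [dh]
  have h3 : aeval (fun i => γ (X 2) ^ w3 i * ![ι xi, ι yi, 1] i) = γ := by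
    ext i
    fin_cases i
    · simp [w3, ← hx]; ring
    · simp [w3, ← hy]; ring
    · simp [w3]
  rw [h3, ← h2] at h1
  rw [h1]
  simp; ring

theorem LocData.zchart [CharZero k] [IsAlgClosed k] (H : LocData f P O L ι γ) 
    (hf : f.IsWeightedHomogeneous w3 9) (hz : (X 2 : R3 k) ∉ P) (hreg : ¬ IsRegLocalRing O) :
    ∃ Q, Sing f Q ∧ ∀ n (r : R3 k), r.IsWeightedHomogeneous w3 n → (r ∈ P ↔ eval Q r = 0) := by
  obtain ⟨θ, hθ⟩ := H.zchart0 hz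
  have hzn : ∀ n, (X 2 : R3 k) ^ n ∉ P := fun n h => hz (hP.mem_of_pow_mem n h)
  have hzh : ∀ n, ((X 2 : R3 k) ^ n).IsWeightedHomogeneous w3 n := fun n => by
    simpa using (homX2 (k := k)).pow n
  have hch : ∀ o, ∃ a b, IsUnit (θ.toRingHom b) ∧ o * θ.toRingHom b = θ.toRingHom a := by
    intro o
    obtain ⟨n, r, s, hr, hs, hsP, h⟩ := H.rep o
    refine ⟨dh r, dh s, (H.unit_iff hs (hzh n) (hzn n) (hθ n s hs)).mpr hsP, ?_⟩
    apply H.inj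
    apply mul_right_cancel₀ (H.ne (hzn n))
    change ι (o * θ (dh s)) * _ = ι (θ (dh r)) * _
    rw [hθ n r hr, map_mul, mul_assoc, hθ n s hs, h]
  haveI : IsNoetherianRing O := noeth_of_chart θ.toRingHom hch
  set q := (IsLocalRing.maximalIdeal O).comap θ.toRingHom with hq
  have hmap : q.map θ.toRingHom = IsLocalRing.maximalIdeal O := ideal_eq_map _ hch _
  have hmem : ∀ n (r : R3 k), r.IsWeightedHomogeneous w3 n → (dh r ∈ q ↔ r ∈ P) := by
    intro n r hr
    exact H.mem_iff hr (hzh n) (hzn n) (hθ n r hr)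
  by_cases hm : q.IsMaximal
  swap
  · obtain ⟨u, hu⟩ := nonmax_principal q hm
    rw [hu, Ideal.map_span, Set.image_singleton] at hmap
    exact absurd (reg_of_principal O _ hmap.symm) hreg
  obtain ⟨v, hv⟩ := (MvPolynomial.isMaximal_iff_eq_vanishingIdeal_singleton).mp hm
  have hqv : ∀ T, T ∈ q ↔ eval v T = 0 := by
    intro T; rw [hv]; simp [mem_vanishingIdeal_iff, aeval_eq_eval]
  have hvv : v = ![v 0, v 1] := by ext i; fin_cases i <;> rfl
  set a := v 0
  set b := v 1
  have hsp := prime_eq_span v q hm.ne_top (fun i => by rw [hqv]; simp)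
  have hr1 : (Set.range fun i => (X i - C (v i) : MvPolynomial (Fin 2) k)) = {X 0 - C a, X 1 - C b} := by
    ext t; simp [Fin.exists_fin_two, eq_comm, a, b]
  rw [hr1] at hsp
  have hF0 : θ (dh f) = 0 := by
    apply H.inj
    apply mul_right_cancel₀ (H.ne (hzn 9))
    rw [hθ 9 f hf, H.f0]; simp
  have hFq : dh f ∈ q := by
    change θ (dh f) ∈ IsLocalRing.maximalIdeal O
    rw [hF0]; exact zero_mem _
  obtain ⟨G, K, hGK⟩ := Ideal.mem_span_pair.mp (hsp ▸ hFq)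
  have e0 : eval v (pderiv 0 (dh f)) = eval v G := by
    rw [← hGK]; simp [Derivation.leibniz, pderiv_X, a, b]
  have e1 : eval v (pderiv 1 (dh f)) = eval v K := by
    rw [← hGK]; simp [Derivation.leibniz, pderiv_X, a, b]
  have hunit : ∀ T, eval v T ≠ 0 → IsUnit (θ T) := by
    intro T hT
    by_contra hnu
    exact hT ((hqv T).mp hnu)
  have hrel : θ G * θ (X 0 - C a) + θ K * θ (X 1 - C b) = 0 := by
    rw [← map_mul, ← map_mul, ← map_add, hGK, hF0]
  have hmx : IsLocalRing.maximalIdeal O = Ideal.span {θ (X 0 - C a), θ (X 1 - C b)} := by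
    rw [← hmap, hsp, Ideal.map_span, Set.image_pair]; rfl
  have z0 : eval v G = 0 := by
    by_contra hne
    obtain ⟨u, hu⟩ := (hunit G hne).exists_left_inv
    apply hreg
    apply reg_of_principal O (θ (X 1 - C b))
    rw [hmx]
    apply le_antisymm
    · rw [Ideal.span_le]
      rintro t (rfl | rfl)
      · rw [SetLike.mem_coe, Ideal.mem_span_singleton']
        exact ⟨- u * θ K, by linear_combination - u * hrel + θ (X 0 - C a) * hu⟩
      · exact Ideal.mem_span_singleton_self _
    · exact Ideal.span_mono (by simp)
  have z1 : eval v K = 0 := by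
    by_contra hne
    obtain ⟨u, hu⟩ := (hunit K hne).exists_left_inv
    apply hreg
    apply reg_of_principal O (θ (X 0 - C a))
    rw [hmx]
    apply le_antisymm
    · rw [Ideal.span_le]
      rintro t (rfl | rfl)
      · exact Ideal.mem_span_singleton_self _
      · rw [SetLike.mem_coe, Ideal.mem_span_singleton']
        exact ⟨- u * θ G, by linear_combination - u * hrel + θ (X 1 - C b) * hu⟩
    · exact Ideal.span_mono (by simp)
  rw [pderiv0_dh, z0, hvv, eval_dh] at e0
  rw [pderiv1_dh, z1, hvv, eval_dh] at e1
  have ef : eval ![a, b, 1] f = 0 := by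
    rw [← eval_dh, ← hvv]; exact (hqv _).mp hFq
  refine ⟨![a, b, 1], ⟨rfl, ef, ?_⟩, ?_⟩
  · intro j
    fin_cases j
    · exact e0
    · exact e1
    · have hE := congrArg (eval ![a, b, 1]) hf.sum_weight_X_mul_pderiv
      simp [Fin.sum_univ_three, w3, ef] at hE
      simp [e0, e1] at hE
      exact hE
  · intro n r hr
    rw [← hmem n r hr, hqv, hvv, eval_dh]
end
end S15

namespace S15
section
variable {k : Type} [Field k] 

lemma X2_dvd_sub (r : R3 k) : (X 2 : R3 k) ∣ r - aeval ![X 0, X 1, (0 : R3 k)] r := by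
  induction r using MvPolynomial.induction_on with
  | C a => simp [algebraMap_eq]
  | add p q hp hq =>
    have := dvd_add hp hq
    convert this using 1
    simp; ring
  | mul_X p i hp =>
    rw [map_mul, aeval_X]
    have h2 : (X 2 : R3 k) ∣ X i - (![X 0, X 1, (0 : R3 k)] i) := by fin_cases i <;> simp
    have := dvd_add (hp.mul_right (X i)) (h2.mul_left (aeval ![X 0, X 1, (0 : R3 k)] p))
    convert this using 1
    ring

lemma C3_decomp [CharZero k] [IsAlgClosed k] {f : R3 k} (hf : f.IsWeightedHomogeneous w3 9) (h3 : CondC3 k f) :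
    ∃ p q : k, p ≠ 0 ∧ q ≠ 0 ∧ ∃ g : R3 k, g.IsWeightedHomogeneous w3 8 ∧
      f = X 0 * (C p * X 0 ^ 2 + C q * X 1 ^ 3) + X 2 * g := by
  obtain ⟨p, q, hp, hq, h⟩ := h3
  refine ⟨p, q, hp, hq, ?_⟩
  have h1 := congrArg (aeval (fun n : ℕ => if n = 0 then (X 0 : R3 k) else X 1)) h
  rw [← AlgHom.comp_apply] at h1
  have h2 : (aeval (fun n : ℕ => if n = 0 then (X 0 : R3 k) else X 1)).comp 
      (aeval ![X 0, X 1, (0 : MvPolynomial ℕ k)]) = aeval ![X 0, X 1, (0 : R3 k)] := by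
    ext i; fin_cases i <;> simp
  rw [h2] at h1
  replace h1 : aeval ![X 0, X 1, (0 : R3 k)] f = X 0 * (C p * X 0 ^ 2 + C q * X 1 ^ 3) := by
    rw [h1]; simp [algebraMap_eq]
  obtain ⟨g, hg⟩ := X2_dvd_sub f
  rw [h1] at hg
  refine ⟨g, ?_, by rw [← hg]; ring⟩
  by_cases h0 : g = 0
  · rw [h0]; exact isWeightedHomogeneous_zero _ _ _
  have hh : (X 2 * g).IsWeightedHomogeneous w3 9 := by
    rw [← hg]
    refine (weightedHomogeneousSubmodule k w3 9).sub_mem hf ?_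
    rw [mul_add]
    refine (weightedHomogeneousSubmodule k w3 9).add_mem ?_ ?_
    · have := (homX0 (k := k)).mul ((isWeightedHomogeneous_C w3 p).mul ((homX0 (k := k)).pow 2))
      simpa using this
    · have := (homX0 (k := k)).mul ((isWeightedHomogeneous_C w3 q).mul ((homX1 (k := k)).pow 3))
      simpa using this
  have hne : (X 2 * g) ≠ 0 := mul_ne_zero (X_ne_zero _) h0
  obtain ⟨m, hm⟩ := homog_of_dvd hh hne (Dvd.intro_left _ rfl)
  have := IsWeightedHomogeneous.inj_right hne hh ((homX2 (k := k)).mul hm)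
  have : m = 8 := by omega
  exact this ▸ hm

variable {f : R3 k} {P : Ideal (R3 k)} [hP : P.IsPrime] {O L : Type} [CommRing O] [IsDomain O] 
  [IsLocalRing O] [CommRing L] [IsDomain L] [Algebra k O] [Algebra k L] {ι : O →ₐ[k] L} 
  {γ : R3 k →ₐ[k] L}

lemma ychart0 (α β c : O) (hα : ι α * γ (X 1) ^ 3 = γ (X 0) ^ 2) 
    (hβ : ι β * γ (X 1) ^ 2 = γ (X 0) * γ (X 2)) (hc : ι c * γ (X 1) = γ (X 2) ^ 2) (n : ℕ) (r : R3 k)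
    (hr : r.IsWeightedHomogeneous w3 (2 * n)) : 
    ∃ T : MvPolynomial (Fin 3) k, ι (aeval ![α, β, c] T) * γ (X 1) ^ n = γ r := by
  have key : ∃ T : MvPolynomial (Fin 3) k, ι (aeval ![α, β, c] T) * γ (X 1) ^ n = γ (∑ v ∈ r.support, monomial v (coeff v r)) := by
    apply Finset.sum_induction _ (fun r => ∃ T : MvPolynomial (Fin 3) k, ι (aeval ![α, β, c] T) * γ (X 1) ^ n = γ r)
    · rintro a b ⟨S, hS⟩ ⟨T, hT⟩
      exact ⟨S + T, by rw [map_add, map_add, map_add, add_mul, hS, hT]⟩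
    · exact ⟨0, by simp⟩
    · intro d hd
      have hw := hr (mem_support_iff.mp hd)
      simp [Finsupp.weight_apply, Finsupp.sum_fintype, w3, Fin.sum_univ_three] at hw
      have hmon : γ (monomial d (coeff d r)) = 
          algebraMap k L (coeff d r) * (γ (X 0) ^ d 0 * γ (X 1) ^ d 1 * γ (X 2) ^ d 2) := by
        rw [monomial_eq, Finsupp.prod_fintype _ _ (by simp), Fin.prod_univ_three, map_mul, map_mul, map_mul,
          map_pow, map_pow, map_pow, ← algebraMap_eq, AlgHom.commutes]
      rw [hmon]
      rcases Nat.even_or_odd' (d 0) with ⟨i, hi | hi⟩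
      · obtain ⟨j, hj⟩ : ∃ j, d 2 = 2 * j := ⟨d 2 / 2, by omega⟩
        have hn : n = 3 * i + d 1 + j := by omega
        refine ⟨C (coeff d r) * (X 0 ^ i * X 2 ^ j), ?_⟩
        rw [hi, hj, pow_mul, pow_mul, ← hα, ← hc, hn]
        simp
        ring
      · obtain ⟨j, hj⟩ : ∃ j, d 2 = 2 * j + 1 := ⟨d 2 / 2, by omega⟩
        have hn : n = 2 + 3 * i + d 1 + j := by omega
        refine ⟨C (coeff d r) * (X 0 ^ i * X 2 ^ j * X 1), ?_⟩
        rw [hi, hj, pow_succ, pow_succ, pow_mul, pow_mul, ← hα, ← hc, hn]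
        simp
        linear_combination (algebraMap k L (coeff d r) * (ι α ^ i * ι c ^ j) * 
          γ (X 1) ^ (3 * i + d 1 + j)) * hβ
  rwa [← as_sum] at key

theorem LocData.ychart [CharZero k] [IsAlgClosed k] (H : LocData f P O L ι γ) 
    (hf : f.IsWeightedHomogeneous w3 9) (h3 : CondC3 k f) (hall : ¬ ∀ i, (X i : R3 k) ∈ P)
    (hz : (X 2 : R3 k) ∈ P) : IsRegLocalRing O := by
  obtain ⟨p, q, hp, hq, g, hg, hfg⟩ := C3_decomp hf h3
  have hfP : f ∈ P := H.ker f H.f0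
  have hxP : X 0 * (C p * X 0 ^ 2 + C q * X 1 ^ 3) ∈ P := by
    have := P.sub_mem hfP (P.mul_mem_right g hz)
    rwa [hfg, add_sub_cancel_right] at this
  have hCu : ∀ t : k, t ≠ 0 → C t ∉ P := fun t ht h =>
    hP.ne_top (Ideal.eq_top_of_isUnit_mem _ h ((isUnit_iff_ne_zero.mpr ht).map C))
  have hyP : (X 1 : R3 k) ∉ P := by
    intro hy
    have h1 : C p * X 0 ^ 3 ∈ P := by
      have := P.sub_mem hxP (P.mul_mem_left (X 0 * C q * X 1 ^ 2) hy)
      convert this using 1; ring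
    have h2 : (X 0 : R3 k) ∈ P := 
      hP.mem_of_pow_mem 3 ((hP.mem_or_mem h1).resolve_left (hCu p hp))
    exact hall (fun i => by fin_cases i <;> assumption)
  have hyn : ∀ n, (X 1 : R3 k) ^ n ∉ P := fun n h => hyP (hP.mem_of_pow_mem n h)
  have hyh : ∀ n, ((X 1 : R3 k) ^ n).IsWeightedHomogeneous w3 (2 * n) := fun n => by
    simpa [mul_comm] using (homX1 (k := k)).pow n
  have hx2 : ((X 0 : R3 k) ^ 2).IsWeightedHomogeneous w3 6 := by simpa using (homX0 (k := k)).pow 2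
  have hz2 : ((X 2 : R3 k) ^ 2).IsWeightedHomogeneous w3 2 := by simpa using (homX2 (k := k)).pow 2
  have hxz : ((X 0 : R3 k) * X 2).IsWeightedHomogeneous w3 4 := (homX0 (k := k)).mul homX2
  obtain ⟨α, hα⟩ := H.frac 6 (X 0 ^ 2) (X 1 ^ 3) hx2 (hyh 3) (hyn 3)
  obtain ⟨β, hβ⟩ := H.frac 4 (X 0 * X 2) (X 1 ^ 2) hxz (hyh 2) (hyn 2)
  obtain ⟨c, hc⟩ := H.frac 2 (X 2 ^ 2) (X 1) hz2 homX1 hyP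
  obtain ⟨η, hη⟩ := H.frac 8 g (X 1 ^ 4) hg (hyh 4) (hyn 4)
  have mα := H.mem_iff hx2 (hyh 3) (hyn 3) hα
  have mβ := (H.mem_iff hxz (hyh 2) (hyn 2) hβ).mpr (P.mul_mem_left _ hz)
  have mc := (H.mem_iff hz2 homX1 hyP hc).mpr (P.pow_mem_of_mem hz 2 (by norm_num))
  have mα' : algebraMap k O p * α + algebraMap k O q ∈ IsLocalRing.maximalIdeal O ↔ 
      (C p * X 0 ^ 2 + C q * X 1 ^ 3) ∈ P := by
    refine H.mem_iff (n := 6) ?_ (hyh 3) (hyn 3) ?_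
    · refine (weightedHomogeneousSubmodule k w3 6).add_mem ?_ ?_
      · simpa using (isWeightedHomogeneous_C w3 p).mul hx2
      · simpa using (isWeightedHomogeneous_C w3 q).mul (hyh 3)
    · simp only [map_add, map_mul, AlgHom.commutes, ← algebraMap_eq, ← hα]
      ring
  have hY := H.ne hyP
  simp only [map_pow, map_mul] at hα hβ hc hη
  set x := γ (X 0)
  set y := γ (X 1)
  set z := γ (X 2)
  have hF := H.f0
  rw [hfg] at hF
  simp only [map_pow, map_mul, map_add, ← algebraMap_eq, AlgHom.commutes] at hF
  change x * (_ * x ^ 2 + _ * y ^ 3) + z * _ = 0 at hF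
  have R1 : α * (algebraMap k O p * α + algebraMap k O q) = - β * η := by
    apply H.inj
    apply mul_right_cancel₀ (pow_ne_zero 6 hY)
    simp only [map_mul, map_add, map_neg, AlgHom.commutes]
    linear_combination (algebraMap k L p * (ι α * y ^ 3 + x ^ 2) + algebraMap k L q * y ^ 3) * hα + x * hF
      + (ι η * y ^ 4) * hβ + x * z * hη
  have R2 : β * (algebraMap k O p * α + algebraMap k O q) = - c * η := by
    apply H.inj
    apply mul_right_cancel₀ (pow_ne_zero 5 hY)
    simp only [map_mul, map_add, map_neg, AlgHom.commutes]
    linear_combination (algebraMap k L p * ι α * y ^ 3 + algebraMap k L q * y ^ 3) * hβ + 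
      (algebraMap k L p * x * z) * hα + z * hF + (ι η * y ^ 4) * hc + z ^ 2 * hη
  have R3' : α * c = β * β := by
    apply H.inj
    apply mul_right_cancel₀ (pow_ne_zero 4 hY)
    simp only [map_mul]
    linear_combination (ι c * y) * hα + x ^ 2 * hc - (ι β * y ^ 2 + x * z) * hβ
  set θ : MvPolynomial (Fin 3) k →ₐ[k] O := aeval ![α, β, c] with hθd
  have hθ := ychart0 α β c hα hβ hc
  have hch : ∀ o, ∃ a b, IsUnit (θ.toRingHom b) ∧ o * θ.toRingHom b = θ.toRingHom a := by
    intro o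
    obtain ⟨n, r, s, hr, hs, hsP, h⟩ := H.rep o
    have hss : (s * s).IsWeightedHomogeneous w3 (2 * n) := two_mul n ▸ hs.mul hs
    have hrs : (r * s).IsWeightedHomogeneous w3 (2 * n) := two_mul n ▸ hr.mul hs
    obtain ⟨T1, h1⟩ := hθ n _ hss
    obtain ⟨T2, h2⟩ := hθ n _ hrs
    have hssP : s * s ∉ P := fun h => (hP.mem_or_mem h).elim hsP hsP
    refine ⟨T2, T1, (H.unit_iff hss (hyh n) (hyn n) (by rw [map_pow]; exact h1)).mpr hssP, ?_⟩
    apply H.inj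
    apply mul_right_cancel₀ (pow_ne_zero n hY)
    change ι (o * θ T1) * _ = ι (θ T2) * _
    rw [h2, map_mul, mul_assoc, h1, map_mul, map_mul, ← h]; ring
  haveI : IsNoetherianRing O := noeth_of_chart θ.toRingHom hch
  have hmap := ideal_eq_map _ hch (IsLocalRing.maximalIdeal O)
  have gen : ∀ v0 : k, α - algebraMap k O v0 ∈ IsLocalRing.maximalIdeal O → 
      ∀ I : Ideal O, α - algebraMap k O v0 ∈ I → β ∈ I → c ∈ I → IsLocalRing.maximalIdeal O ≤ I := by
    intro v0 hv0 I h1 h2 h3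
    rw [← hmap, prime_eq_span ![v0, 0, 0] _ (Ideal.comap_ne_top _ (IsLocalRing.maximalIdeal.isMaximal O).ne_top),
      Ideal.map_le_iff_le_comap, Ideal.span_le]
    · rintro _ ⟨i, rfl⟩
      fin_cases i
      · simpa [θ, Ideal.mem_comap] using h1
      · simpa [θ, Ideal.mem_comap] using h2
      · simpa [θ, Ideal.mem_comap] using h3
    · intro i
      fin_cases i
      · simpa [θ, Ideal.mem_comap] using hv0
      · simpa [θ, Ideal.mem_comap] using mβ
      · simpa [θ, Ideal.mem_comap] using mc
  have inv : ∀ o, o ∉ IsLocalRing.maximalIdeal O → ∃ u, u * o = 1 := by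
    intro o ho
    have : IsUnit o := by
      by_contra h
      exact ho h
    exact this.exists_left_inv
  have hpp : algebraMap k O p * algebraMap k O p⁻¹ = 1 := by
    rw [← map_mul, mul_inv_cancel₀ hp, map_one]
  by_cases hx : (X 0 : R3 k) ∈ P
  · apply reg_of_principal O c
    have hα0 : α ∈ IsLocalRing.maximalIdeal O := mα.mpr (P.pow_mem_of_mem hx 2 (by norm_num))
    have hu : algebraMap k O p * α + algebraMap k O q ∉ IsLocalRing.maximalIdeal O := by
      rw [mα']
      intro h
      have h1 := P.sub_mem h (P.mul_mem_left (C p) (P.pow_mem_of_mem hx 2 (by norm_num)))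
      rw [add_sub_cancel_left] at h1
      exact (hP.mem_or_mem h1).elim (hCu q hq) (hyn 3)
    obtain ⟨u, hu⟩ := inv _ hu
    have hβc : β ∈ Ideal.span {c} := by
      rw [Ideal.mem_span_singleton']
      exact ⟨- u * η, by linear_combination - u * R2 + β * hu⟩
    have hαc : α ∈ Ideal.span {c} := by
      have : α = (- u * η) * β := by linear_combination u * R1 - α * hu
      rw [this]; exact Ideal.mul_mem_left _ _ hβc
    apply le_antisymm
    · exact gen 0 (by simpa using hα0) _ (by simpa using hαc) hβc (Ideal.mem_span_singleton_self _)
    · rw [Ideal.span_singleton_le_iff_mem]; exact mc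
  · apply reg_of_principal O β
    have hα0 : α ∉ IsLocalRing.maximalIdeal O := fun h => hx (hP.mem_of_pow_mem 2 (mα.mp h))
    obtain ⟨u, hu⟩ := inv _ hα0
    have hA : algebraMap k O p * α + algebraMap k O q ∈ IsLocalRing.maximalIdeal O := 
      mα'.mpr ((hP.mem_or_mem hxP).resolve_left hx)
    have he : α - algebraMap k O (- (q * p⁻¹)) = 
        algebraMap k O p⁻¹ * (algebraMap k O p * α + algebraMap k O q) := by
      rw [map_neg, map_mul]; linear_combination - α * hpp
    have hB : algebraMap k O p * α + algebraMap k O q ∈ Ideal.span {β} := by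
      rw [Ideal.mem_span_singleton']
      exact ⟨- u * η, by 
        linear_combination - u * R1 + (algebraMap k O p * α + algebraMap k O q) * hu⟩
    have hC : c ∈ Ideal.span {β} := by
      rw [Ideal.mem_span_singleton']
      exact ⟨u * β, by linear_combination - u * R3' + c * hu⟩
    apply le_antisymm
    · exact gen (- (q * p⁻¹)) (by rw [he]; exact Ideal.mul_mem_left _ _ hA) _ 
        (by rw [he]; exact Ideal.mul_mem_left _ _ hB) (Ideal.mem_span_singleton_self _) hC
    · rw [Ideal.span_singleton_le_iff_mem]; exact mβ
end
end S15

namespace S15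
section
variable {k : Type} [Field k] {f : R3 k} (ℬ : ℕ → Submodule k (R3 k ⧸ Ideal.span {f})) [GradedAlgebra ℬ]

lemma proj_mk (hB : ∀ (i : ℕ) (r : R3 k), r.IsWeightedHomogeneous w3 i → 
      Ideal.Quotient.mk (Ideal.span {f}) r ∈ ℬ i) (i : ℕ) (r : R3 k) :
    (DirectSum.decompose ℬ (Ideal.Quotient.mk (Ideal.span {f}) r) i : R3 k ⧸ Ideal.span {f}) = 
      Ideal.Quotient.mk (Ideal.span {f}) (weightedHomogeneousComponent w3 i r) := by
  induction r using MvPolynomial.induction_on' with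
  | monomial d a =>
    have h : (monomial d a : R3 k).IsWeightedHomogeneous w3 (Finsupp.weight w3 d) := 
      isWeightedHomogeneous_monomial w3 d a rfl
    rw [weightedHomogeneousComponent_of_mem h]
    split_ifs with h1
    · subst h1; exact DirectSum.decompose_of_mem_same _ (hB _ _ h)
    · rw [map_zero]; exact DirectSum.decompose_of_mem_ne _ (hB _ _ h) (Ne.symm h1)
  | add p q hp hq =>
    rw [(Ideal.Quotient.mk (Ideal.span {f})).map_add, DirectSum.decompose_add, DirectSum.add_apply, Submodule.coe_add,
      hp, hq, (weightedHomogeneousComponent w3 i).map_add, (Ideal.Quotient.mk (Ideal.span {f})).map_add]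

lemma lift_homog (hB : ∀ (i : ℕ) (r : R3 k), r.IsWeightedHomogeneous w3 i → 
      Ideal.Quotient.mk (Ideal.span {f}) r ∈ ℬ i) (i : ℕ) (b : R3 k ⧸ Ideal.span {f}) (hb : b ∈ ℬ i) :
    ∃ r : R3 k, r.IsWeightedHomogeneous w3 i ∧ Ideal.Quotient.mk (Ideal.span {f}) r = b := by
  obtain ⟨r, rfl⟩ := Ideal.Quotient.mk_surjective b
  refine ⟨weightedHomogeneousComponent w3 i r, weightedHomogeneousComponent_isWeightedHomogeneous _ _, ?_⟩
  rw [← proj_mk ℬ hB, DirectSum.decompose_of_mem_same _ hb]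

theorem atPrime_point [CharZero k] [IsAlgClosed k] 
    (hB : ∀ (i : ℕ) (r : R3 k), r.IsWeightedHomogeneous w3 i → 
      Ideal.Quotient.mk (Ideal.span {f}) r ∈ ℬ i)
    (hf : f.IsWeightedHomogeneous w3 9) (hirr : Irreducible f) (h3 : CondC3 k f)
    (𝔭 : Ideal (R3 k ⧸ Ideal.span {f})) [h𝔭 : 𝔭.IsPrime] 
    (hall : ¬ ∀ i, Ideal.Quotient.mk (Ideal.span {f}) (X i) ∈ 𝔭)
    (hreg : ¬ IsRegLocalRing (HomogeneousLocalization.AtPrime ℬ 𝔭)) :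
    ∃ Q, Sing f Q ∧ ∀ n (r : R3 k), r.IsWeightedHomogeneous w3 n → 
      (Ideal.Quotient.mk (Ideal.span {f}) r ∈ 𝔭 ↔ eval Q r = 0) := by
  haveI : (Ideal.span {f}).IsPrime := (Ideal.span_singleton_prime hirr.ne_zero).mpr hirr.prime
  haveI : IsDomain (R3 k ⧸ Ideal.span {f}) := Ideal.Quotient.isDomain _
  let B := R3 k ⧸ Ideal.span {f}
  let O := HomogeneousLocalization.AtPrime ℬ 𝔭
  let L := Localization.AtPrime 𝔭
  have hle : 𝔭.primeCompl ≤ nonZeroDivisors B := Ideal.primeCompl_le_nonZeroDivisors 𝔭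
  haveI : IsDomain L := IsLocalization.isDomain_localization hle
  letI aO : Algebra k O := 
    ((HomogeneousLocalization.fromZeroRingHom ℬ 𝔭.primeCompl).comp (algebraMap k (ℬ 0))).toAlgebra
  have hinj : Function.Injective (algebraMap O L) := HomogeneousLocalization.val_injective _
  haveI : IsDomain O := hinj.isDomain (algebraMap O L)
  let ι : O →ₐ[k] L := 
    { algebraMap O L with
      commutes' := fun c => by
        change Localization.mk (algebraMap k B c) 1 = _
        rw [Localization.mk_one_eq_algebraMap, ← IsScalarTower.algebraMap_apply] }
  let γ : R3 k →ₐ[k] L := (IsScalarTower.toAlgHom k B L).comp (Ideal.Quotient.mkₐ k (Ideal.span {f}))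
  have hγ : ∀ r, γ r = algebraMap B L (Ideal.Quotient.mk (Ideal.span {f}) r) := fun r => rfl
  let P : Ideal (R3 k) := 𝔭.comap (Ideal.Quotient.mk (Ideal.span {f}))
  have hP : ∀ r, r ∈ P ↔ Ideal.Quotient.mk (Ideal.span {f}) r ∈ 𝔭 := fun r => Iff.rfl
  have H : LocData f P O L ι γ := by
    refine ⟨hinj, ?_, ?_, ?_, ?_⟩
    · rw [hγ, Ideal.Quotient.eq_zero_iff_mem.mpr (Ideal.mem_span_singleton_self f), map_zero]
    · intro r hr
      rw [hγ] at hr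
      have := (IsLocalization.injective L hle) (hr.trans (map_zero _).symm)
      rw [hP, this]; exact zero_mem _
    · intro o
      obtain ⟨c, rfl⟩ := HomogeneousLocalization.mk_surjective o
      obtain ⟨r, hr, hr'⟩ := lift_homog ℬ hB c.deg c.num c.num.2
      obtain ⟨s, hs, hs'⟩ := lift_homog ℬ hB c.deg c.den c.den.2
      refine ⟨c.deg, r, s, hr, hs, ?_, ?_⟩
      · rw [hP, hs']; exact c.den_mem
      · rw [hγ, hγ, hr', hs']
        change (HomogeneousLocalization.mk c).val * _ = _
        rw [HomogeneousLocalization.val_mk, ← Localization.mk_one_eq_algebraMap, 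
          ← Localization.mk_one_eq_algebraMap, Localization.mk_mul, Localization.mk_eq_mk_iff,
          Localization.r_iff_exists]
        exact ⟨1, by simp; ring⟩
    · intro n r s hr hs hsP
      refine ⟨HomogeneousLocalization.mk ⟨n, ⟨_, hB n r hr⟩, ⟨_, hB n s hs⟩, hsP⟩, ?_⟩
      rw [hγ, hγ]
      change (HomogeneousLocalization.mk _).val * _ = _
      rw [HomogeneousLocalization.val_mk, ← Localization.mk_one_eq_algebraMap, 
          ← Localization.mk_one_eq_algebraMap, Localization.mk_mul, Localization.mk_eq_mk_iff,
          Localization.r_iff_exists]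
      exact ⟨1, by simp; ring⟩
  haveI : P.IsPrime := Ideal.IsPrime.comap _
  by_cases hz : (X 2 : R3 k) ∈ P
  · exact absurd (H.ychart hf h3 hall hz) hreg
  · exact H.zchart hf hz hreg

theorem proj_point [CharZero k] [IsAlgClosed k] 
    (hB : ∀ (i : ℕ) (r : R3 k), r.IsWeightedHomogeneous w3 i → 
      Ideal.Quotient.mk (Ideal.span {f}) r ∈ ℬ i)
    (hf : f.IsWeightedHomogeneous w3 9) (hirr : Irreducible f) (h3 : CondC3 k f)
    (x : AlgebraicGeometry.Proj ℬ)
    (hreg : ¬ IsRegLocalRing ((AlgebraicGeometry.Proj ℬ).presheaf.stalk x)) :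
    ∃ Q, Sing f Q ∧ ∀ n (r : R3 k), r.IsWeightedHomogeneous w3 n → 
      (Ideal.Quotient.mk (Ideal.span {f}) r ∈ x.asHomogeneousIdeal.toIdeal ↔ eval Q r = 0) := by
  haveI : x.asHomogeneousIdeal.toIdeal.IsPrime := x.isPrime
  refine atPrime_point ℬ hB hf hirr h3 x.asHomogeneousIdeal.toIdeal ?_ ?_
  · intro hall
    apply x.not_irrelevant_le
    intro b hb
    obtain ⟨r, rfl⟩ := Ideal.Quotient.mk_surjective b
    have h0 : (DirectSum.decompose ℬ (Ideal.Quotient.mk (Ideal.span {f}) r) 0 : R3 k ⧸ Ideal.span {f}) = 0 :=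
      (HomogeneousIdeal.mem_irrelevant_iff ℬ _).mp hb
    rw [proj_mk ℬ hB, homog_zero_const (weightedHomogeneousComponent_isWeightedHomogeneous 0 r)] at h0
    have hc : coeff 0 (weightedHomogeneousComponent w3 0 r) = coeff 0 r := by
      rw [coeff_weightedHomogeneousComponent]; simp
    rw [hc] at h0
    have h1 := sub_eval_mem (0 : Fin 3 → k) r
    have h2 : r - C (eval 0 r) ∈ x.asHomogeneousIdeal.toIdeal.comap (Ideal.Quotient.mk (Ideal.span {f})) := by
      refine (Ideal.span_le.mpr ?_) h1
      rintro _ ⟨i, rfl⟩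
      simpa using hall i
    have h4 : eval 0 r = coeff 0 r := by 
      rw [← constantCoeff_eq, ← eval_zero]
    rw [Ideal.mem_comap, map_sub, h4, h0, sub_zero] at h2
    exact h2
  · intro h
    exact hreg (reg_equiv (AlgebraicGeometry.Proj.stalkIso ℬ x).commRingCatIsoToRingEquiv.symm h)

theorem C2_two [CharZero k] [IsAlgClosed k] (hf : f.IsWeightedHomogeneous w3 9) (hirr : Irreducible f)
    (h2 : CondC2 k f) (h3 : CondC3 k f) : ∃ Q1 Q2, Q1 ≠ Q2 ∧ Sing f Q1 ∧ Sing f Q2 := by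
  classical
  obtain ⟨ℬ, inst, hB, x, y, hxy, hx, hy⟩ := h2
  obtain ⟨Q1, hQ1, h1⟩ := proj_point ℬ hB hf hirr h3 x hx
  obtain ⟨Q2, hQ2, h2⟩ := proj_point ℬ hB hf hirr h3 y hy
  refine ⟨Q1, Q2, ?_, hQ1, hQ2⟩
  rintro rfl
  apply hxy
  apply ProjectiveSpectrum.ext
  apply HomogeneousIdeal.ext
  have key : ∀ I J : HomogeneousIdeal ℬ, (∀ n (r : R3 k), r.IsWeightedHomogeneous w3 n → 
      (Ideal.Quotient.mk (Ideal.span {f}) r ∈ I.toIdeal → Ideal.Quotient.mk (Ideal.span {f}) r ∈ J.toIdeal)) →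
      I.toIdeal ≤ J.toIdeal := by
    intro I J h b hb
    rw [← DirectSum.sum_support_decompose ℬ b]
    refine Ideal.sum_mem _ (fun i _ => ?_)
    obtain ⟨r, hr, hr'⟩ := lift_homog ℬ hB i _ (DirectSum.decompose ℬ b i).2
    have h3 := I.isHomogeneous i hb
    rw [← hr'] at h3 ⊢
    exact h i r hr h3
  exact le_antisymm (key _ _ fun n r hr h => (h2 n r hr).mpr ((h1 n r hr).mp h))
    (key _ _ fun n r hr h => (h1 n r hr).mpr ((h2 n r hr).mp h))
end
end S15

/-- Lemma 3.2 (corollary): under Setup 3.1 (`f ∈ R₉` satisfies (C1)-(C3), `D` is an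
irreducible homogeneous locally nilpotent derivation with `D²f = 0`, and
`ker D = k[g,h]` with `g, h` homogeneous of degrees `d ≤ e`):
(a) `f` is a local slice for `D` (`Df ≠ 0`);
(b) `z ∉ ker D`;
(c) up to multiplication by an element of `k*`, `g` equals `y + a z²` or `x + a yz + b z³`;
(d) `rank D = 2` (corank `≥ 1` but not `≥ 2`);
(e) `2 ≤ d ≤ 3` and `e ≥ 5`. -/
theorem statement_15 (k : Type) [Field k] [IsAlgClosed k] [CharZero k]
    (f : MvPolynomial (Fin 3) k)
    (hf9 : f.IsWeightedHomogeneous w3 9)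
    (hC1 : Irreducible f)
    (hC2 : CondC2 k f)
    (hC3 : CondC3 k f)
    (D : Derivation k (MvPolynomial (Fin 3) k) (MvPolynomial (Fin 3) k))
    (hlnd : IsLND D) (hirr : IsIrreducibleDeriv D)
    (hhom : ∃ m : ℤ, DerivIsHomogOfDeg w3 D m)
    (hD2f : D (D f) = 0)
    (g h : MvPolynomial (Fin 3) k) (d e : ℕ)
    (hg : g.IsWeightedHomogeneous w3 d) (hh : h.IsWeightedHomogeneous w3 e)
    (hde : d ≤ e)
    (hker : ∀ r : MvPolynomial (Fin 3) k,
      D r = 0 ↔ r ∈ Algebra.adjoin k ({g, h} : Set (MvPolynomial (Fin 3) k))) :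
    D f ≠ 0 ∧
    D (X 2) ≠ 0 ∧
    (∃ μ : k, μ ≠ 0 ∧
      ((∃ a : k, g = C μ * (X 1 + C a * X 2 ^ 2)) ∨
       (∃ a b : k, g = C μ * (X 0 + C a * X 1 * X 2 + C b * X 2 ^ 3)))) ∧
    (CorankGe D 1 ∧ ¬ CorankGe D 2) ∧
    (2 ≤ d ∧ d ≤ 3 ∧ 5 ≤ e) := by
  obtain ⟨m, hm⟩ := hhom
  obtain ⟨Q1, Q2, hne, h1, h2⟩ := S15.C2_two hf9 hC1 hC2 hC3
  exact absurd (S15.no_two hlnd hirr hm hf9 hC1 hC3 hD2f h1 h2) hne
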